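/- arXiv:1702.06431 — 4 statements merged into one kernel-verified Lean document; each statement's English description precedes it below -/
import Mathlib

section
/- Let n ≥ 1 and let (m_i)_{1≤i≤n}, (m_{ij})_{1≤i<j≤n} be real numbers with m_i ≥ 0 and m_{ij} ≥ 0 for all i < j, and assume fracturedness. Then the quantum symmetrizer formula holds: F₋((m_i, m_{ij})_{ij}) = ∑_{σ ∈ S_n} q(σ) · F̃₋((m_{σ⁻¹(i)}; m_{σ⁻¹(i)σ⁻¹(j)})_{ij}), where the sum is over all permutations σ of {1,…,n}. -/
open MeasureTheory
open scoped Classical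

/-- The formal residue coefficient `Res(m)`. -/
noncomputable def Res (m : ℝ) : ℂ :=
  if m = -1 then 1
  else if ∃ z : ℤ, (z : ℝ) = m then 0
  else (Complex.exp (2 * Real.pi * Complex.I * ((m : ℂ) + 1)) - 1) /
    (2 * Real.pi * Complex.I * ((m : ℂ) + 1))

/-- Generalized binomial coefficient `binom(m, k)` for a real `m`. -/
noncomputable def gbinom (m : ℝ) (k : ℕ) : ℝ :=
  (∏ i ∈ Finset.range k, (m - i)) / (Nat.factorial k)

/-- Upper-triangular index pairs `i < j` in `Fin n`. -/
abbrev UT (n : ℕ) := {p : Fin n × Fin n // p.1 < p.2}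

/-- The exponent `E_i = m_i + ∑_{j>i}(m_{ij} - k_{ij}) + ∑_{j<i} k_{ji}`. -/
noncomputable def Eexp (n : ℕ) (m : Fin n → ℝ) (mm : Fin n → Fin n → ℝ)
    (K : UT n → ℕ) (i : Fin n) : ℝ :=
  m i + (∑ p : UT n, (if p.1.1 = i then mm p.1.1 p.1.2 - K p else 0))
      + ∑ p : UT n, (if p.1.2 = i then (K p : ℝ) else 0)

/-- One term of the series defining the quantum monodromy number `F₋`. -/
noncomputable def FminusTerm (n : ℕ) (m : Fin n → ℝ) (mm : Fin n → Fin n → ℝ)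
    (K : UT n → ℕ) : ℂ :=
  (∏ i : Fin n, Res (Eexp n m mm K i)) *
    ∏ p : UT n, ((-1 : ℂ) ^ K p * (gbinom (mm p.1.1 p.1.2) (K p) : ℂ))

/-- The quantum monodromy number `F₋((m_i, m_{ij})_{ij})`. -/
noncomputable def Fminus (n : ℕ) (m : Fin n → ℝ) (mm : Fin n → Fin n → ℝ) : ℂ :=
  ∑' K : UT n → ℕ, FminusTerm n m mm K

/-- The simplex `1 ≥ z₁ > ⋯ > zₙ ≥ 0`. -/
def simplexSet (n : ℕ) : Set (Fin n → ℝ) :=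
  {z | (∀ i, 0 ≤ z i ∧ z i ≤ 1) ∧ ∀ i j : Fin n, i < j → z j < z i}

/-- The generalized Selberg integral `Sel((m_i; m̄_i; m_{ij}))`. -/
noncomputable def Sel (n : ℕ) (m mbar : Fin n → ℝ) (mm : Fin n → Fin n → ℝ) : ℝ :=
  ∫ z in simplexSet n,
    (∏ i, z i ^ m i) * (∏ i, (1 - z i) ^ mbar i) *
      ∏ p : UT n, (z p.1.1 - z p.1.2) ^ mm p.1.1 p.1.2

/-- The shuffles `S_{k, \overline{n-k}}`: increasing on the first `k` positions,
decreasing on the remaining positions (0-indexed). -/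
def SbarFinset (n k : ℕ) : Finset (Equiv.Perm (Fin n)) :=
  Finset.univ.filter (fun η =>
    (∀ i j : Fin n, i < j → (j : ℕ) < k → η i < η j) ∧
    (∀ i j : Fin n, i < j → k ≤ (i : ℕ) → η j < η i))

/-- The inversion number `ℓ(η)` of a permutation. -/
def invNum {n : ℕ} (η : Equiv.Perm (Fin n)) : ℕ :=
  (Finset.univ.filter (fun p : Fin n × Fin n => p.1 < p.2 ∧ η p.2 < η p.1)).card

/-- The reduced quantum monodromy number `F̃₋((m_i; m_{ij}))`. -/
noncomputable def Ftilde (n : ℕ) (m : Fin n → ℝ) (mm : Fin n → Fin n → ℝ) : ℂ :=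
  (2 * Real.pi * Complex.I)⁻¹ ^ n *
    ∑ k ∈ Finset.range (n + 1), (-1 : ℂ) ^ k *
      (∏ i ∈ Finset.univ.filter (fun i : Fin n => k ≤ (i : ℕ)),
        Complex.exp (2 * Real.pi * Complex.I * (m i))) *
      ∑ η ∈ SbarFinset n k,
        (∏ p ∈ Finset.univ.filter
            (fun p : Fin n × Fin n => p.1 < p.2 ∧ η p.2 < η p.1),
          Complex.exp (Real.pi * Complex.I * (mm p.1 p.2))) *
        (Sel n (fun i => m (η⁻¹ i)) (fun _ => 0) (fun i j => mm (η⁻¹ i) (η⁻¹ j)) : ℂ)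

/-- The braiding factor `q(σ) = exp(πi ∑_{i<j, σ(i)>σ(j)} m_{ij})`. -/
noncomputable def qfac {n : ℕ} (mm : Fin n → Fin n → ℝ) (σ : Equiv.Perm (Fin n)) : ℂ :=
  Complex.exp (Real.pi * Complex.I *
    (∑ p ∈ Finset.univ.filter (fun p : Fin n × Fin n => p.1 < p.2 ∧ σ p.2 < σ p.1),
      (mm p.1 p.2 : ℂ)))

/-- The Euler Beta function as a real integral. -/
noncomputable def Beta (x y : ℝ) : ℝ :=
  ∫ t in (0:ℝ)..1, t ^ (x - 1) * (1 - t) ^ (y - 1)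

theorem integral_image_pi {n : ℕ} (ψ ψ' : Fin n → ℝ → ℝ) (s : Set (Fin n → ℝ))
    (hs : MeasurableSet s)
    (hd : ∀ x ∈ s, ∀ i, HasDerivAt (ψ i) (ψ' i (x i)) (x i))
    (hinj : ∀ x ∈ s, ∀ y ∈ s, ∀ i, ψ i (x i) = ψ i (y i) → x i = y i) (g : (Fin n → ℝ) → ℂ) :
    ∫ z in (fun x i => ψ i (x i)) '' s, g z =
      ∫ x in s, (∏ i, |ψ' i (x i)| : ℝ) • g (fun i => ψ i (x i)) := by
  have := integral_image_eq_integral_abs_det_fderiv_smul (μ := volume) (s := s)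
    (f := fun (x : Fin n → ℝ) i => ψ i (x i))
    (f' := fun x => ContinuousLinearMap.pi fun i =>
      (ContinuousLinearMap.toSpanSingleton ℝ (ψ' i (x i))).comp (ContinuousLinearMap.proj i))
    hs ?_ ?_ g
  · rw [this]
    refine setIntegral_congr_fun hs fun x _ => ?_
    simp only [ContinuousLinearMap.det_pi]
    congr 1
    rw [Finset.abs_prod]
    refine Finset.prod_congr rfl fun i _ => ?_
    simp [ContinuousLinearMap.det]
  · intro x hx
    rw [hasFDerivWithinAt_pi]
    intro i
    have h1 : HasFDerivAt (ψ i) (ContinuousLinearMap.toSpanSingleton ℝ (ψ' i (x i))) (x i) :=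
      (hd x hx i).hasFDerivAt
    exact (h1.comp x (ContinuousLinearMap.proj (R := ℝ)
      (φ := fun _ : Fin n => ℝ) i).hasFDerivAt).hasFDerivWithinAt
  · intro x hx y hy h
    ext i
    exact hinj x hx y hy i (congrFun h i)

theorem volume_coord_eq {n : ℕ} {i j : Fin n} (h : i ≠ j) :
    volume {x : Fin n → ℝ | x i = x j} = 0 := by
  let p : Submodule ℝ (Fin n → ℝ) :=
    LinearMap.ker (LinearMap.proj (R := ℝ) (φ := fun _ : Fin n => ℝ) i - LinearMap.proj j)
  have hp : ({x : Fin n → ℝ | x i = x j}) = p := by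
    ext x; simp [p, sub_eq_zero]
  rw [hp]
  refine Measure.addHaar_submodule _ _ fun htop => ?_
  have : Pi.single i (1:ℝ) ∈ p := by rw [htop]; trivial
  simp [p, h.symm] at this

theorem ae_injective (n : ℕ) : ∀ᵐ x : Fin n → ℝ, Function.Injective x := by
  have : ∀ᵐ x : Fin n → ℝ, ∀ i j, i ≠ j → x i ≠ x j := by
    rw [ae_all_iff]; intro i
    rw [ae_all_iff]; intro j
    by_cases h : i = j
    · simp [h]
    · have := compl_mem_ae_iff.2 (volume_coord_eq h)
      filter_upwards [this] with x hx _ using hx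
  filter_upwards [this] with x hx i j hij
  by_contra hne
  exact hx i j hne hij

theorem measurableSet_strictMono (n : ℕ) : MeasurableSet {x : Fin n → ℝ | StrictMono x} := by
  have : {x : Fin n → ℝ | StrictMono x} = ⋂ i, ⋂ j, {x | i < j → x i < x j} := by
    ext x; simp [StrictMono]
  rw [this]
  refine MeasurableSet.iInter fun i => MeasurableSet.iInter fun j => ?_
  by_cases h : i < j
  · simp only [h, true_imp_iff]
    exact measurableSet_lt (measurable_pi_apply i) (measurable_pi_apply j)
  · simp [h]

theorem measurePreserving_perm {n : ℕ} (σ : Equiv.Perm (Fin n)) :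
    MeasurePreserving (fun y : Fin n → ℝ => fun i => y (σ i)) volume volume := by
  have h := (volume_measurePreserving_piCongrLeft (fun _ : Fin n => ℝ) σ).symm
  exact h

theorem measurableEmbedding_perm {n : ℕ} (σ : Equiv.Perm (Fin n)) :
    MeasurableEmbedding (fun y : Fin n → ℝ => fun i => y (σ i)) :=
  (MeasurableEquiv.piCongrLeft (fun _ : Fin n => ℝ) σ).symm.measurableEmbedding

theorem integral_eq_sum_perm {n : ℕ} (D : Set (Fin n → ℝ)) (hD : MeasurableSet D)
    (g : (Fin n → ℝ) → ℂ) (hg : IntegrableOn g D) :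
    ∫ x in D, g x = ∑ σ : Equiv.Perm (Fin n),
      ∫ y in {y | StrictMono y ∧ (fun i => y (σ i)) ∈ D}, g (fun i => y (σ i)) := by
  let O : Equiv.Perm (Fin n) → Set (Fin n → ℝ) := fun σ => {x | StrictMono fun i => x (σ⁻¹ i)}
  have hO : ∀ σ, MeasurableSet (O σ) := fun σ =>
    (measurePreserving_perm σ⁻¹).measurable (measurableSet_strictMono n)
  have hdis : Pairwise (Function.onFun Disjoint fun σ => D ∩ O σ) := by
    intro σ τ hne
    refine Set.disjoint_left.2 fun x hx hx' => hne ?_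
    have h1 : StrictMono fun i => x (σ⁻¹ i) := hx.2
    have h2 : StrictMono fun i => x (τ⁻¹ i) := hx'.2
    have h3 : (fun i => x (σ⁻¹ i)) = fun i => x (τ⁻¹ i) := by
      refine (StrictMono.range_inj h1 h2).1 ?_
      have e1 : Set.range (fun i => x (σ⁻¹ i)) = Set.range x := (σ⁻¹).surjective.range_comp x
      have e2 : Set.range (fun i => x (τ⁻¹ i)) = Set.range x := (τ⁻¹).surjective.range_comp x
      rw [e1, e2]
    have hinj : Function.Injective x := by
      intro a b hab
      have := h1.injective (a₁ := σ a) (a₂ := σ b) (by simpa using hab)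
      exact σ.injective this
    have : σ⁻¹ = τ⁻¹ := by
      ext i
      exact congrArg _ (hinj (congrFun h3 i))
    exact inv_injective this
  have hU : (D : Set (Fin n → ℝ)) =ᵐ[volume] ⋃ σ, D ∩ O σ := by
    filter_upwards [ae_injective n] with x hx
    apply propext
    constructor
    · intro hxD
      refine Set.mem_iUnion.2 ⟨(Tuple.sort x)⁻¹, hxD, ?_⟩
      have := (Tuple.monotone_sort x).strictMono_of_injective (hx.comp (Tuple.sort x).injective)
      exact this
    · intro h
      obtain ⟨σ, hσ⟩ := Set.mem_iUnion.1 h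
      exact hσ.1
  rw [setIntegral_congr_set hU, integral_iUnion_fintype (fun σ => hD.inter (hO σ)) hdis
    (fun σ => hg.mono_set Set.inter_subset_left)]
  refine Finset.sum_congr rfl fun σ _ => ?_
  rw [← (measurePreserving_perm σ).setIntegral_preimage_emb (measurableEmbedding_perm σ)]
  congr 2
  ext y
  simp [O, and_comm]

/-- The pair `{η i, η j}` in increasing order. -/
noncomputable def utMap {n : ℕ} (η : Equiv.Perm (Fin n)) (p : UT n) : UT n :=
  if h : η p.1.1 < η p.1.2 then ⟨(η p.1.1, η p.1.2), h⟩
  else ⟨(η p.1.2, η p.1.1), lt_of_le_of_ne (not_lt.1 h) fun e => p.2.ne' (η.injective e)⟩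

theorem utMap_utMap {n : ℕ} (η : Equiv.Perm (Fin n)) (p : UT n) :
    utMap η⁻¹ (utMap η p) = p := by
  obtain ⟨⟨i, j⟩, h⟩ := p
  simp only at h
  unfold utMap
  by_cases h1 : η i < η j
  · simp [h1, h]
  · simp [h1, h.not_gt]

theorem prod_pairs_perm {n : ℕ} (η : Equiv.Perm (Fin n)) (G : Fin n → Fin n → ℂ)
    (hG : ∀ i j, i ≠ j → G i j = G j i) :
    ∏ p : UT n, G (η p.1.1) (η p.1.2) = ∏ p : UT n, G p.1.1 p.1.2 := by
  let e : UT n ≃ UT n := ⟨utMap η, utMap η⁻¹, utMap_utMap η, fun p => by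
    simpa using utMap_utMap η⁻¹ p⟩
  rw [← e.prod_comp fun p : UT n => G p.1.1 p.1.2]
  refine Finset.prod_congr rfl fun p _ => ?_
  change G _ _ = G (utMap η p).1.1 (utMap η p).1.2
  unfold utMap
  split_ifs with h
  · rfl
  · exact hG _ _ fun e => p.2.ne (η.injective e)

theorem prod_filter_pairs {n : ℕ} (P : Fin n → Fin n → Prop) (G : Fin n → Fin n → ℂ) :
    ∏ p ∈ Finset.univ.filter (fun p : Fin n × Fin n => p.1 < p.2 ∧ P p.1 p.2), G p.1 p.2 =
      ∏ p : UT n, if P p.1.1 p.1.2 then G p.1.1 p.1.2 else 1 := by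
  rw [← Finset.prod_subtype (Finset.univ.filter (fun p : Fin n × Fin n => p.1 < p.2))
    (by simp) (fun p : Fin n × Fin n => if P p.1 p.2 then G p.1 p.2 else 1),
    ← Finset.prod_filter, Finset.filter_filter]

theorem gbinom_succ (m : ℝ) (k : ℕ) : ((k : ℝ) + 1) * gbinom m (k + 1) = (m - k) * gbinom m k := by
  unfold gbinom
  rw [Finset.prod_range_succ, Nat.factorial_succ]
  have : (k.factorial : ℝ) ≠ 0 := by positivity
  have : (k : ℝ) + 1 ≠ 0 := by positivity
  push_cast
  field_simp

theorem summable_abs_gbinom {m : ℝ} (hm : 0 ≤ m) : Summable fun k => |gbinom m k| := by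
  rcases hm.eq_or_lt with rfl | hm
  · refine summable_of_ne_finset_zero (s := {0}) fun k hk => ?_
    have : k ≠ 0 := by simpa using hk
    have : ∏ i ∈ Finset.range k, ((0 : ℝ) - i) = 0 :=
      Finset.prod_eq_zero (i := 0) (by simp; omega) (by simp)
    rw [gbinom, this, zero_div, abs_zero]
  · obtain ⟨N, hN⟩ := exists_nat_ge m
    rw [← summable_nat_add_iff N]
    have key : ∀ k, m * |gbinom m (k + N)| =
        ((k + N : ℕ) : ℝ) * |gbinom m (k + N)| -
          ((k + 1 + N : ℕ) : ℝ) * |gbinom m (k + 1 + N)| := by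
      intro k
      have h := congrArg abs (gbinom_succ m (k + N))
      have h0 : m - ((k + N : ℕ) : ℝ) ≤ 0 := by
        push_cast
        have : (0 : ℝ) ≤ k := by positivity
        linarith
      rw [abs_mul, abs_mul, abs_of_nonpos h0, abs_of_nonneg (by positivity)] at h
      rw [show k + 1 + N = k + N + 1 by ring]
      push_cast at h ⊢
      linarith
    refine summable_of_sum_range_le (c := N * |gbinom m N| / m) (fun _ => abs_nonneg _) fun K => ?_
    rw [le_div_iff₀ hm, mul_comm, Finset.mul_sum, Finset.sum_congr rfl fun k _ => key k,
      Finset.sum_range_sub']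
    have : 0 ≤ ((K + N : ℕ) : ℝ) * |gbinom m (K + N)| := by positivity
    simp only [zero_add]
    linarith

theorem gbinom_eq_choose (m : ℝ) (k : ℕ) : gbinom m k = Ring.choose m k := by
  have h := Ring.descPochhammer_eq_factorial_smul_choose m k
  have h2 : (descPochhammer ℤ k).smeval m = ∏ i ∈ Finset.range k, (m - i) := by
    clear h
    induction k with
    | zero => simp [Polynomial.smeval_one]
    | succ k ih =>
      rw [descPochhammer_succ_right, Polynomial.smeval_mul, ih, Finset.prod_range_succ,
        Polynomial.smeval_sub, Polynomial.smeval_X, Polynomial.smeval_natCast]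
      simp
  rw [h2, nsmul_eq_mul] at h
  unfold gbinom
  rw [h]
  have : (k.factorial : ℝ) ≠ 0 := by positivity
  field_simp

theorem hasSum_binomial {m : ℝ} {u : ℂ} (hu : ‖u‖ < 1) :
    HasSum (fun k : ℕ => (-1 : ℂ) ^ k * (gbinom m k : ℂ) * u ^ k) ((1 - u) ^ (m : ℂ)) := by
  have h := (Complex.one_add_cpow_hasFPowerSeriesOnBall_zero (a := (m : ℂ))).hasSum
    (y := -u) (by simpa [Metric.mem_eball, edist_zero_right, ← ofReal_norm, ENNReal.ofReal_lt_one] using hu)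
  rw [zero_add, ← sub_eq_add_neg] at h
  refine (congrArg (fun f => HasSum f _) (funext fun k => ?_)).mp h
  rw [binomialSeries_apply, gbinom_eq_choose, Complex.ofReal_choose, List.ofFn_const,
    List.prod_replicate, smul_eq_mul, neg_pow]
  ring

theorem hasSum_binomial_closed {m : ℝ} (hm : 0 ≤ m) {u : ℂ} (hu : ‖u‖ ≤ 1) (hu1 : u ≠ 1) :
    HasSum (fun k : ℕ => (-1 : ℂ) ^ k * (gbinom m k : ℂ) * u ^ k) ((1 - u) ^ (m : ℂ)) := by
  have hs : Summable (fun k : ℕ => (-1 : ℂ) ^ k * (gbinom m k : ℂ) * u ^ k) := by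
    refine Summable.of_norm_bounded (summable_abs_gbinom hm) fun k => ?_
    simp only [norm_mul, norm_pow, norm_neg, norm_one, one_pow, one_mul, Complex.norm_real,
      Real.norm_eq_abs]
    exact mul_le_of_le_one_right (abs_nonneg _) (pow_le_one₀ (norm_nonneg _) hu)
  have hsl : 1 - u ∈ Complex.slitPlane := by
    rw [Complex.mem_slitPlane_iff]
    by_cases h : u.re < 1
    · left; simpa using h
    · right
      intro him
      apply hu1
      have h1 : u.re ≤ 1 := (Complex.re_le_norm u).trans hu
      apply Complex.ext
      · simp; linarith
      · simpa using him
  have h1 : Filter.Tendsto (fun r : ℝ => (1 - (r : ℂ) * u) ^ (m : ℂ)) (nhdsWithin 1 (Set.Iio 1))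
      (nhds ((1 - u) ^ (m : ℂ))) := by
    have : ContinuousAt (fun r : ℝ => (1 - (r : ℂ) * u) ^ (m : ℂ)) 1 := by
      refine ContinuousAt.cpow (by fun_prop) continuousAt_const (by simpa using hsl)
    have h2 := this.tendsto
    simp only [Complex.ofReal_one, one_mul] at h2
    exact h2.mono_left nhdsWithin_le_nhds
  have h2 : Filter.Tendsto
      (fun r : ℝ => ∑' k : ℕ, (-1 : ℂ) ^ k * (gbinom m k : ℂ) * ((r : ℂ) * u) ^ k)
      (nhdsWithin 1 (Set.Iio 1)) (nhds (∑' k : ℕ, (-1 : ℂ) ^ k * (gbinom m k : ℂ) * u ^ k)) := by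
    refine tendsto_tsum_of_dominated_convergence (summable_abs_gbinom hm) (fun k => ?_) ?_
    · have : Continuous (fun r : ℝ => (-1 : ℂ) ^ k * (gbinom m k : ℂ) * ((r : ℂ) * u) ^ k) := by
        fun_prop
      have h2 := this.tendsto 1
      simp only [Complex.ofReal_one, one_mul] at h2
      exact h2.mono_left nhdsWithin_le_nhds
    · filter_upwards [Ioo_mem_nhdsLT (show (0 : ℝ) < 1 by norm_num)] with r hr k
      simp only [norm_mul, norm_pow, norm_neg, norm_one, one_pow, one_mul, Complex.norm_real,
        Real.norm_eq_abs]
      refine mul_le_of_le_one_right (abs_nonneg _) (pow_le_one₀ (by positivity) ?_)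
      rw [abs_of_pos hr.1]
      nlinarith [norm_nonneg u, hr.1, hr.2]
  have h3 : ∀ᶠ r : ℝ in nhdsWithin 1 (Set.Iio 1), (1 - (r : ℂ) * u) ^ (m : ℂ) =
      ∑' k : ℕ, (-1 : ℂ) ^ k * (gbinom m k : ℂ) * ((r : ℂ) * u) ^ k := by
    filter_upwards [Ioo_mem_nhdsLT (show (0 : ℝ) < 1 by norm_num)] with r hr
    refine (hasSum_binomial ?_).tsum_eq.symm
    rw [norm_mul, Complex.norm_real, Real.norm_eq_abs, abs_of_pos hr.1]
    nlinarith [norm_nonneg u, hr.1, hr.2]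
  have := tendsto_nhds_unique (h1.congr' h3) h2
  rw [this]
  exact hs.hasSum

theorem hasSum_pi_prod_equiv {α β : Type*} [Fintype α] [Fintype β] (e : α ≃ β)
    (h : ∀ f : α → ℕ → ℂ, (∀ i, Summable fun k => ‖f i k‖) →
      Summable (fun K : α → ℕ => ‖∏ i, f i (K i)‖) ∧
      HasSum (fun K : α → ℕ => ∏ i, f i (K i)) (∏ i, ∑' k, f i k))
    (f : β → ℕ → ℂ) (hf : ∀ i, Summable fun k => ‖f i k‖) :
      Summable (fun K : β → ℕ => ‖∏ i, f i (K i)‖) ∧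
      HasSum (fun K : β → ℕ => ∏ i, f i (K i)) (∏ i, ∑' k, f i k) := by
  obtain ⟨h1, h2⟩ := h (fun a => f (e a)) fun a => hf (e a)
  let E : (β → ℕ) ≃ (α → ℕ) := e.symm.arrowCongr (Equiv.refl ℕ)
  have hE : ∀ K : β → ℕ, ∏ a, f (e a) (E K a) = ∏ b, f b (K b) := by
    intro K
    rw [← e.prod_comp]
    rfl
  refine ⟨?_, ?_⟩
  · rw [← E.summable_iff] at h1
    exact h1.congr fun K => congrArg norm (hE K)
  · rw [← E.hasSum_iff] at h2
    rw [← e.prod_comp]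
    exact (congrArg (fun f => HasSum f _) (funext fun K => hE K)).mp h2

theorem hasSum_pi_prod_fin (n : ℕ) (f : Fin n → ℕ → ℂ)
    (hf : ∀ i, Summable fun k => ‖f i k‖) :
      Summable (fun K : Fin n → ℕ => ‖∏ i, f i (K i)‖) ∧
      HasSum (fun K : Fin n → ℕ => ∏ i, f i (K i)) (∏ i, ∑' k, f i k) := by
  induction n with
  | zero =>
    simp only [Finset.univ_eq_empty, Finset.prod_empty]
    exact ⟨Summable.of_finite, by simp⟩
  | succ n h =>
    obtain ⟨h1, h2⟩ := h (fun a => f a.succ) fun a => hf a.succ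
    let E : (Fin (n + 1) → ℕ) ≃ ℕ × (Fin n → ℕ) :=
      ⟨fun K => (K 0, fun a => K a.succ), fun x => Fin.cons x.1 x.2,
        fun K => funext fun i => by cases i using Fin.cases <;> rfl, fun x => rfl⟩
    have hE : ∀ K : Fin (n + 1) → ℕ,
        (fun x : ℕ × (Fin n → ℕ) => f 0 x.1 * ∏ a, f (Fin.succ a) (x.2 a)) (E K) =
          ∏ b, f b (K b) := by
      intro K
      exact (Fin.prod_univ_succ fun b => f b (K b)).symm
    have h3 : Summable fun x : ℕ × (Fin n → ℕ) => ‖f 0 x.1 * ∏ a, f (Fin.succ a) (x.2 a)‖ :=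
      Summable.mul_norm (f := f 0) (g := fun K : Fin n → ℕ => ∏ a, f (Fin.succ a) (K a)) (hf 0) h1
    refine ⟨?_, ?_⟩
    · rw [← E.summable_iff] at h3
      exact h3.congr fun K => congrArg norm (hE K)
    · have h4 := (hf 0).of_norm.hasSum.mul h2 h3.of_norm
      rw [← E.hasSum_iff] at h4
      rw [Fin.prod_univ_succ]
      exact (congrArg (fun f => HasSum f _) (funext fun K => hE K)).mp h4

theorem hasSum_pi_prod {ι : Type*} [Fintype ι] (f : ι → ℕ → ℂ)
    (hf : ∀ i, Summable fun k => ‖f i k‖) :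
      Summable (fun K : ι → ℕ => ‖∏ i, f i (K i)‖) ∧
      HasSum (fun K : ι → ℕ => ∏ i, f i (K i)) (∏ i, ∑' k, f i k) :=
  hasSum_pi_prod_equiv (Fintype.equivFin ι).symm (hasSum_pi_prod_fin _) f hf

/-- The open unit cube. -/
def unitCube (n : ℕ) : Set (Fin n → ℝ) := Set.univ.pi fun _ => Set.Ioo 0 1

theorem measurableSet_unitCube (n : ℕ) : MeasurableSet (unitCube n) :=
  MeasurableSet.univ_pi fun _ => measurableSet_Ioo

theorem volume_unitCube (n : ℕ) : volume (unitCube n) = 1 := by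
  simp [unitCube, Real.volume_pi_Ioo]

/-- The integrand `∏ z_i^{m_i} ∏ (z_i - z_j)^{m_ij} dz` on the unit circle, `z_i = exp (2πi t_i)`. -/
noncomputable def circleIntegrand (n : ℕ) (m : Fin n → ℝ) (mm : Fin n → Fin n → ℝ)
    (t : Fin n → ℝ) : ℂ :=
  (∏ i, Complex.exp (2 * Real.pi * Complex.I * t i * (m i + 1))) *
    ∏ p : UT n, (Complex.exp (2 * Real.pi * Complex.I * t p.1.1 * mm p.1.1 p.1.2) *
      (1 - Complex.exp (2 * Real.pi * Complex.I * (t p.1.2 - t p.1.1))) ^ (mm p.1.1 p.1.2 : ℂ))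

theorem Res_eq_integral {E : ℝ} (hE : ¬ ∃ z : ℤ, (z : ℝ) = E) :
    Res E = ∫ t in Set.Ioo (0 : ℝ) 1, Complex.exp (2 * Real.pi * Complex.I * t * (E + 1)) := by
  have h1 : E ≠ -1 := fun h => hE ⟨-1, by simp [h]⟩
  have h2 : ((E : ℂ) + 1) ≠ 0 := by
    intro h
    apply h1
    have : (E : ℂ) = -1 := by linear_combination h
    exact_mod_cast this
  have hc : (2 * Real.pi * Complex.I * ((E : ℂ) + 1)) ≠ 0 :=
    mul_ne_zero Complex.two_pi_I_ne_zero h2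
  rw [Res, if_neg h1, if_neg hE, ← integral_Ioc_eq_integral_Ioo,
    ← intervalIntegral.integral_of_le zero_le_one]
  have := integral_exp_mul_complex (a := 0) (b := 1) hc
  simp only [Complex.ofReal_one, mul_one, Complex.ofReal_zero, mul_zero, Complex.exp_zero] at this
  rw [← this]
  congr 1
  ext t
  congr 1
  ring

theorem sum_UT_fst {n : ℕ} (mm : Fin n → Fin n → ℝ) (i : Fin n) :
    ∑ p : UT n, (if p.1.1 = i then mm p.1.1 p.1.2 else 0) =
      ∑ j ∈ Finset.univ.filter (fun j => i < j), mm i j := by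
  rw [← Finset.sum_subtype (Finset.univ.filter (fun p : Fin n × Fin n => p.1 < p.2))
    (by simp) (fun p : Fin n × Fin n => if p.1 = i then mm p.1 p.2 else 0), Finset.sum_filter,
    Fintype.sum_prod_type, Finset.sum_eq_single i]
  · simp [Finset.sum_filter]
  · intro b _ hb
    simp [hb]
  · simp

theorem Eexp_not_int {n : ℕ} {m : Fin n → ℝ} {mm : Fin n → Fin n → ℝ}
    (hfrac : ∀ i : Fin n,
      ¬ ∃ z : ℤ, (z : ℝ) = m i + ∑ j ∈ Finset.univ.filter (fun j => i < j), mm i j)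
    (K : UT n → ℕ) (i : Fin n) : ¬ ∃ z : ℤ, (z : ℝ) = Eexp n m mm K i := by
  rintro ⟨z, hz⟩
  refine hfrac i ⟨z + (∑ p : UT n, if p.1.1 = i then (K p : ℤ) else 0) -
    ∑ p : UT n, (if p.1.2 = i then (K p : ℤ) else 0), ?_⟩
  rw [← sum_UT_fst]
  push_cast
  rw [hz, Eexp]
  have : ∑ p : UT n, (if p.1.1 = i then mm p.1.1 p.1.2 - K p else 0) =
      ∑ p : UT n, (if p.1.1 = i then mm p.1.1 p.1.2 else 0) -
        ∑ p : UT n, (if p.1.1 = i then (K p : ℝ) else 0) := by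
    rw [← Finset.sum_sub_distrib]
    refine Finset.sum_congr rfl fun p _ => ?_
    split_ifs <;> simp
  rw [this]
  ring

theorem sum_mul_Eexp {n : ℕ} (m : Fin n → ℝ) (mm : Fin n → Fin n → ℝ) (K : UT n → ℕ)
    (t : Fin n → ℝ) : ∑ i, t i * Eexp n m mm K i =
      ∑ i, t i * m i + ∑ p : UT n, (t p.1.1 * (mm p.1.1 p.1.2 - K p) + t p.1.2 * K p) := by
  simp only [Eexp, mul_add, Finset.sum_add_distrib, Finset.mul_sum, add_assoc]
  congr 1
  congr 1
  · rw [Finset.sum_comm]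
    refine Finset.sum_congr rfl fun p _ => ?_
    simp
  · rw [Finset.sum_comm]
    refine Finset.sum_congr rfl fun p _ => ?_
    simp

theorem prod_exp_Eexp {n : ℕ} (m : Fin n → ℝ) (mm : Fin n → Fin n → ℝ) (K : UT n → ℕ)
    (t : Fin n → ℝ) :
    ∏ i, Complex.exp (2 * Real.pi * Complex.I * t i * (Eexp n m mm K i + 1)) =
      (∏ i, Complex.exp (2 * Real.pi * Complex.I * t i * (m i + 1))) *
      ∏ p : UT n, (Complex.exp (2 * Real.pi * Complex.I * t p.1.1 * mm p.1.1 p.1.2) *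
        Complex.exp (2 * Real.pi * Complex.I * (t p.1.2 - t p.1.1)) ^ K p) := by
  simp only [← Complex.exp_nat_mul, ← Complex.exp_add, ← Complex.exp_sum]
  congr 1
  have h := congrArg (fun x : ℝ => (x : ℂ)) (sum_mul_Eexp m mm K t)
  push_cast at h
  have e1 : ∀ f : Fin n → ℝ, ∑ i, 2 * Real.pi * Complex.I * t i * ((f i : ℂ) + 1) =
      2 * Real.pi * Complex.I * (∑ i, (t i : ℂ) * f i) +
        2 * Real.pi * Complex.I * ∑ i, (t i : ℂ) := by
    intro f
    rw [Finset.mul_sum, Finset.mul_sum, ← Finset.sum_add_distrib]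
    exact Finset.sum_congr rfl fun i _ => by ring
  rw [e1, e1, h, mul_add, add_right_comm]
  congr 1
  rw [Finset.mul_sum]
  exact Finset.sum_congr rfl fun p _ => by ring

theorem exp_two_pi_sub_ne_one {a b : ℝ} (ha : a ∈ Set.Ioo (0 : ℝ) 1) (hb : b ∈ Set.Ioo (0 : ℝ) 1)
    (hab : a ≠ b) : Complex.exp (2 * Real.pi * Complex.I * ((b : ℂ) - a)) ≠ 1 := by
  intro h
  obtain ⟨k, hk⟩ := Complex.exp_eq_one_iff.1 h
  have h2 : ((b : ℂ) - a) = k := by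
    apply mul_left_cancel₀ Complex.two_pi_I_ne_zero
    linear_combination hk
  have h3 : b - a = k := by exact_mod_cast h2
  have h4 : (k : ℝ) < 1 := by rw [← h3]; linarith [ha.1, hb.2]
  have h5 : (-1 : ℝ) < k := by rw [← h3]; linarith [ha.2, hb.1]
  have h6 : k < 1 := by exact_mod_cast h4
  have h7 : -1 < k := by exact_mod_cast h5
  have : k = 0 := by omega
  rw [this] at h3
  apply hab
  simp at h3
  linarith

theorem norm_exp_two_pi_mul (t E : ℝ) :
    ‖Complex.exp (2 * Real.pi * Complex.I * t * E)‖ = 1 := by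
  rw [show 2 * (Real.pi : ℂ) * Complex.I * t * E = ((2 * Real.pi * t * E : ℝ) : ℂ) * Complex.I by
    push_cast; ring]
  exact Complex.norm_exp_ofReal_mul_I _

theorem Fminus_eq_integral {n : ℕ} {m : Fin n → ℝ} {mm : Fin n → Fin n → ℝ}
    (hmm : ∀ i j : Fin n, i < j → 0 ≤ mm i j)
    (hfrac : ∀ i : Fin n,
      ¬ ∃ z : ℤ, (z : ℝ) = m i + ∑ j ∈ Finset.univ.filter (fun j => i < j), mm i j) :
    Fminus n m mm = ∫ t in unitCube n, circleIntegrand n m mm t := by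
  let c : (UT n → ℕ) → ℂ := fun K =>
    ∏ p : UT n, ((-1 : ℂ) ^ K p * (gbinom (mm p.1.1 p.1.2) (K p) : ℂ))
  let F : (UT n → ℕ) → (Fin n → ℝ) → ℂ := fun K t =>
    (∏ i, Complex.exp (2 * Real.pi * Complex.I * t i * (Eexp n m mm K i + 1))) * c K
  have hc : Summable fun K => ‖c K‖ := by
    refine (hasSum_pi_prod (fun (p : UT n) k =>
      ((-1 : ℂ) ^ k * (gbinom (mm p.1.1 p.1.2) k : ℂ))) fun p => ?_).1
    simpa using summable_abs_gbinom (hmm _ _ p.2)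
  have hnorm : ∀ K t, ‖F K t‖ = ‖c K‖ := by
    intro K t
    simp only [F, norm_mul, norm_prod]
    rw [Finset.prod_eq_one, one_mul]
    intro i _
    have := norm_exp_two_pi_mul (t i) (Eexp n m mm K i + 1)
    push_cast at this
    exact this
  have hfin : volume (unitCube n) ≠ ⊤ := by rw [volume_unitCube]; simp
  have hFc : ∀ K, Continuous (F K) := fun K => by fun_prop
  have hFi : ∀ K, IntegrableOn (F K) (unitCube n) := fun K =>
    Measure.integrableOn_of_bounded (M := ‖c K‖) hfin (hFc K).aestronglyMeasurable
      (Filter.Eventually.of_forall fun t => (hnorm K t).le)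
  have hFs : Summable fun K => ∫ t in unitCube n, ‖F K t‖ := by
    simp only [hnorm]
    simpa [Measure.real, volume_unitCube] using hc
  have h := hasSum_integral_of_summable_integral_norm hFi hFs
  have hterm : ∀ K, ∫ t in unitCube n, F K t = FminusTerm n m mm K := by
    intro K
    simp only [F, FminusTerm]
    rw [integral_mul_const, unitCube, volume_pi, Measure.restrict_pi_pi,
      integral_fintype_prod_eq_prod
        (fun i (s : ℝ) => Complex.exp (2 * Real.pi * Complex.I * s * (Eexp n m mm K i + 1)))]
    simp only [c, Res_eq_integral (Eexp_not_int hfrac K _)]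
  simp only [hterm] at h
  rw [Fminus, h.tsum_eq]
  refine setIntegral_congr_ae (measurableSet_unitCube n) ?_
  filter_upwards [ae_injective n] with t ht htc
  have hpt : ∀ p : UT n, ∑' k : ℕ, (-1 : ℂ) ^ k * (gbinom (mm p.1.1 p.1.2) k : ℂ) *
      Complex.exp (2 * Real.pi * Complex.I * (t p.1.2 - t p.1.1)) ^ k =
      (1 - Complex.exp (2 * Real.pi * Complex.I * (t p.1.2 - t p.1.1))) ^
        (mm p.1.1 p.1.2 : ℂ) := fun p => by
    refine (hasSum_binomial_closed (hmm _ _ p.2) ?_ ?_).tsum_eq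
    · have := norm_exp_two_pi_mul (t p.1.2 - t p.1.1) 1
      push_cast at this
      rw [mul_one] at this
      exact this.le
    · exact exp_two_pi_sub_ne_one (htc _ trivial) (htc _ trivial) (ht.ne p.2.ne)
  have hps := (hasSum_pi_prod (fun (p : UT n) k => (-1 : ℂ) ^ k *
      (gbinom (mm p.1.1 p.1.2) k : ℂ) *
      Complex.exp (2 * Real.pi * Complex.I * (t p.1.2 - t p.1.1)) ^ k) fun p => by
    have hn := norm_exp_two_pi_mul (t p.1.2 - t p.1.1) 1
    push_cast at hn
    rw [mul_one] at hn
    simpa [hn] using summable_abs_gbinom (hmm _ _ p.2)).2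
  simp only [hpt] at hps
  rw [circleIntegrand, Finset.prod_mul_distrib, ← hps.tsum_eq, ← mul_assoc, ← tsum_mul_left]
  congr 1
  ext K
  simp only [F, c]
  rw [prod_exp_Eexp]
  simp only [Finset.prod_mul_distrib]
  ring

/-- The branch of `(e^a - e^b)^m` which is holomorphic on `0 < Im (b - a) < 2π`. -/
noncomputable def pairBranch (m : ℝ) (a b : ℂ) : ℂ :=
  Complex.exp (m * (a + b) / 2 - Real.pi * Complex.I * m / 2) *
    (-2 * Complex.I * Complex.sinh ((b - a) / 2)) ^ (m : ℂ)

/-- The form `∏ z_i^{m_i} ∏ (z_i - z_j)^{m_ij} dz` in logarithmic coordinates `z_i = exp w_i`. -/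
noncomputable def logIntegrand {n : ℕ} (m : Fin n → ℝ) (mm : Fin n → Fin n → ℝ)
    (w : Fin n → ℂ) : ℂ :=
  (∏ i, Complex.exp (w i * (m i + 1))) *
    ∏ p : UT n, pairBranch (mm p.1.1 p.1.2) (w p.1.1) (w p.1.2)

/-- The open simplex `0 < t₁ < ⋯ < tₙ < 1`. -/
def openSimplex (n : ℕ) : Set (Fin n → ℝ) := {t | StrictMono t ∧ t ∈ unitCube n}

theorem measurableSet_openSimplex (n : ℕ) : MeasurableSet (openSimplex n) :=
  (measurableSet_strictMono n).inter (measurableSet_unitCube n)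

theorem polar_cpow {r α : ℝ} (hr : 0 < r) (h1 : -Real.pi < α) (h2 : α ≤ Real.pi) (m : ℝ) :
    ((r : ℂ) * Complex.exp (α * Complex.I)) ^ (m : ℂ) =
      ((r ^ m : ℝ) : ℂ) * Complex.exp (m * α * Complex.I) := by
  have hr' : (r : ℂ) ≠ 0 := by exact_mod_cast hr.ne'
  rw [Complex.cpow_def_of_ne_zero (mul_ne_zero hr' (Complex.exp_ne_zero _)),
    Complex.log_ofReal_mul hr (Complex.exp_ne_zero _),
    Complex.log_exp (by simpa using h1) (by simpa using h2), Complex.ofReal_cpow hr.le,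
    Complex.cpow_def_of_ne_zero hr', ← Complex.exp_add, Complex.ofReal_log hr.le]
  congr 1
  ring

theorem pairBranch_circle {a b : ℝ} (ha : a ∈ Set.Ioo (0 : ℝ) 1) (hb : b ∈ Set.Ioo (0 : ℝ) 1)
    (hab : a < b) (m : ℝ) :
    pairBranch m (2 * Real.pi * Complex.I * a) (2 * Real.pi * Complex.I * b) =
      (((2 * Real.sin (Real.pi * (b - a))) ^ m : ℝ) : ℂ) *
        Complex.exp (m * (Real.pi * (a + b) - Real.pi / 2) * Complex.I) := by
  have hs : 0 < Real.sin (Real.pi * (b - a)) :=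
    Real.sin_pos_of_pos_of_lt_pi (mul_pos Real.pi_pos (by linarith))
      (by nlinarith [Real.pi_pos, ha.1, hb.2])
  have h1 : (-2 * Complex.I * Complex.sinh
      ((2 * Real.pi * Complex.I * b - 2 * Real.pi * Complex.I * a) / 2)) =
      ((2 * Real.sin (Real.pi * (b - a)) : ℝ) : ℂ) := by
    rw [show (2 * Real.pi * Complex.I * b - 2 * Real.pi * Complex.I * a) / 2 =
      (Real.pi * (b - a) : ℂ) * Complex.I by ring, Complex.sinh_mul_I]
    push_cast
    linear_combination (-2 * Complex.sin (Real.pi * (b - a))) * Complex.I_sq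
  rw [pairBranch, h1, Complex.ofReal_cpow (by positivity), mul_comm]
  congr 2
  ring

theorem circle_pair_of_lt {a b : ℝ} (ha : a ∈ Set.Ioo (0 : ℝ) 1) (hb : b ∈ Set.Ioo (0 : ℝ) 1)
    (hab : a < b) (m : ℝ) :
    Complex.exp (2 * Real.pi * Complex.I * a * m) *
      (1 - Complex.exp (2 * Real.pi * Complex.I * (b - a))) ^ (m : ℂ) =
    pairBranch m (2 * Real.pi * Complex.I * a) (2 * Real.pi * Complex.I * b) := by
  have hs : 0 < Real.sin (Real.pi * (b - a)) :=
    Real.sin_pos_of_pos_of_lt_pi (mul_pos Real.pi_pos (by linarith))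
      (by nlinarith [Real.pi_pos, ha.1, hb.2])
  have h1 : 1 - Complex.exp (2 * Real.pi * Complex.I * (b - a)) =
      ((2 * Real.sin (Real.pi * (b - a)) : ℝ) : ℂ) *
        Complex.exp ((Real.pi * (b - a) - Real.pi / 2 : ℝ) * Complex.I) := by
    rw [show 2 * Real.pi * Complex.I * (b - a) = (Real.pi * (b - a) : ℂ) * Complex.I +
      (Real.pi * (b - a) : ℂ) * Complex.I by ring]
    push_cast
    rw [sub_mul, Complex.exp_sub, Complex.exp_pi_div_two_mul_I, Complex.exp_add,
      Complex.div_I, Complex.exp_mul_I]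
    linear_combination -(Complex.sin_sq_add_cos_sq (Real.pi * (b - a))) +
      (Complex.sin (Real.pi * (b - a))) ^ 2 * Complex.I_sq
  rw [pairBranch_circle ha hb hab, h1, polar_cpow (by positivity)
    (by nlinarith [Real.pi_pos]) (by nlinarith [Real.pi_pos, ha.1, hb.2]), mul_left_comm,
    ← Complex.exp_add]
  congr 2
  push_cast
  ring

theorem circle_pair_of_gt {a b : ℝ} (ha : a ∈ Set.Ioo (0 : ℝ) 1) (hb : b ∈ Set.Ioo (0 : ℝ) 1)
    (hab : b < a) (m : ℝ) :
    Complex.exp (2 * Real.pi * Complex.I * a * m) *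
      (1 - Complex.exp (2 * Real.pi * Complex.I * (b - a))) ^ (m : ℂ) =
    Complex.exp (Real.pi * Complex.I * m) *
      pairBranch m (2 * Real.pi * Complex.I * b) (2 * Real.pi * Complex.I * a) := by
  have hs : 0 < Real.sin (Real.pi * (a - b)) :=
    Real.sin_pos_of_pos_of_lt_pi (mul_pos Real.pi_pos (by linarith))
      (by nlinarith [Real.pi_pos, ha.2, hb.1])
  have h1 : 1 - Complex.exp (2 * Real.pi * Complex.I * (b - a)) =
      ((2 * Real.sin (Real.pi * (a - b)) : ℝ) : ℂ) *
        Complex.exp ((Real.pi / 2 - Real.pi * (a - b) : ℝ) * Complex.I) := by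
    rw [show 2 * Real.pi * Complex.I * (b - a) = -(Real.pi * (a - b) : ℂ) * Complex.I +
      -(Real.pi * (a - b) : ℂ) * Complex.I by ring]
    push_cast
    rw [sub_eq_add_neg (Real.pi / 2 : ℂ), add_mul, Complex.exp_add, Complex.exp_add,
      Complex.exp_pi_div_two_mul_I, Complex.exp_mul_I, Complex.cos_neg, Complex.sin_neg]
    linear_combination -(Complex.sin_sq_add_cos_sq (Real.pi * (a - b))) +
      (Complex.sin (Real.pi * (a - b))) ^ 2 * Complex.I_sq
  rw [pairBranch_circle hb ha hab, h1, polar_cpow (by positivity)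
    (by nlinarith [Real.pi_pos, ha.2, hb.1]) (by nlinarith [Real.pi_pos]), mul_left_comm,
    mul_left_comm (Complex.exp (Real.pi * Complex.I * m)), ← Complex.exp_add, ← Complex.exp_add]
  congr 2
  push_cast
  ring

theorem qfac_eq_prod {n : ℕ} (mm : Fin n → Fin n → ℝ) (σ : Equiv.Perm (Fin n)) :
    qfac mm σ = ∏ p : UT n, if σ p.1.2 < σ p.1.1 then
      Complex.exp (Real.pi * Complex.I * mm p.1.1 p.1.2) else 1 := by
  rw [qfac, Finset.mul_sum, Complex.exp_sum]
  convert prod_filter_pairs (fun i j => σ j < σ i)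
    (fun i j => Complex.exp (Real.pi * Complex.I * mm i j)) using 2
  · ext p
    simp
  · split_ifs <;> rfl

theorem circleIntegrand_perm {n : ℕ} (m : Fin n → ℝ) {mm : Fin n → Fin n → ℝ}
    (hsymm : ∀ i j, mm i j = mm j i) (σ : Equiv.Perm (Fin n)) {y : Fin n → ℝ}
    (hy : y ∈ openSimplex n) :
    circleIntegrand n m mm (fun i => y (σ i)) =
      qfac mm σ * logIntegrand (fun i => m (σ⁻¹ i)) (fun i j => mm (σ⁻¹ i) (σ⁻¹ j))
        (fun i => 2 * Real.pi * Complex.I * y i) := by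
  let w : Fin n → ℂ := fun i => 2 * Real.pi * Complex.I * y i
  let G : Fin n → Fin n → ℂ := fun i j =>
    if i < j then pairBranch (mm (σ⁻¹ i) (σ⁻¹ j)) (w i) (w j)
    else pairBranch (mm (σ⁻¹ i) (σ⁻¹ j)) (w j) (w i)
  have hG : ∀ i j, i ≠ j → G i j = G j i := by
    intro i j hij
    simp only [G]
    rw [hsymm (σ⁻¹ j)]
    rcases lt_or_gt_of_ne hij with h | h
    · simp [h, h.not_gt]
    · simp [h, h.not_gt]
  have h1 : ∀ p : UT n, Complex.exp (2 * Real.pi * Complex.I * y (σ p.1.1) * mm p.1.1 p.1.2) *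
      (1 - Complex.exp (2 * Real.pi * Complex.I * (y (σ p.1.2) - y (σ p.1.1)))) ^
        (mm p.1.1 p.1.2 : ℂ) =
      (if σ p.1.2 < σ p.1.1 then Complex.exp (Real.pi * Complex.I * mm p.1.1 p.1.2) else 1) *
        G (σ p.1.1) (σ p.1.2) := by
    intro p
    have hne : σ p.1.1 ≠ σ p.1.2 := fun h => p.2.ne (σ.injective h)
    rcases lt_or_gt_of_ne hne with h | h
    · rw [circle_pair_of_lt (hy.2 _ trivial) (hy.2 _ trivial) (hy.1 h)]
      simp [G, h, h.not_gt, w]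
    · rw [circle_pair_of_gt (hy.2 _ trivial) (hy.2 _ trivial) (hy.1 h)]
      simp [G, h, h.not_gt, w]
  rw [circleIntegrand, Finset.prod_congr rfl fun p _ => h1 p, Finset.prod_mul_distrib,
    prod_pairs_perm σ G hG, ← qfac_eq_prod, logIntegrand, mul_left_comm]
  congr 2
  · rw [← Equiv.prod_comp σ
      fun x => Complex.exp (2 * Real.pi * Complex.I * y x * (m (σ⁻¹ x) + 1))]
    simp
  · refine Finset.prod_congr rfl fun p _ => ?_
    simp [G, p.2, w]

theorem integrableOn_circleIntegrand {n : ℕ} (m : Fin n → ℝ) {mm : Fin n → Fin n → ℝ}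
    (hmm : ∀ i j : Fin n, i < j → 0 ≤ mm i j) :
    IntegrableOn (circleIntegrand n m mm) (unitCube n) := by
  have hfin : volume (unitCube n) ≠ ⊤ := by rw [volume_unitCube]; simp
  refine Measure.integrableOn_of_bounded (M := ∏ p : UT n, 2 ^ mm p.1.1 p.1.2) hfin ?_
    (Filter.Eventually.of_forall fun t => ?_)
  · refine Measurable.aestronglyMeasurable ?_
    unfold circleIntegrand
    fun_prop
  · simp only [circleIntegrand, norm_mul, norm_prod]
    rw [Finset.prod_eq_one, one_mul]
    · refine Finset.prod_le_prod (fun _ _ => by positivity) fun p _ => ?_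
      rw [norm_exp_two_pi_mul, one_mul, Complex.norm_cpow_real]
      refine Real.rpow_le_rpow (norm_nonneg _) ?_ (hmm _ _ p.2)
      refine (norm_sub_le _ _).trans ?_
      have := norm_exp_two_pi_mul (t p.1.2 - t p.1.1) 1
      push_cast at this
      rw [mul_one] at this
      rw [this]
      norm_num
    · intro i _
      have := norm_exp_two_pi_mul (t i) (m i + 1)
      push_cast at this
      exact this

theorem Fminus_eq_sum {n : ℕ} {m : Fin n → ℝ} {mm : Fin n → Fin n → ℝ}
    (hsymm : ∀ i j, mm i j = mm j i) (hmm : ∀ i j : Fin n, i < j → 0 ≤ mm i j)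
    (hfrac : ∀ i : Fin n,
      ¬ ∃ z : ℤ, (z : ℝ) = m i + ∑ j ∈ Finset.univ.filter (fun j => i < j), mm i j) :
    Fminus n m mm = ∑ σ : Equiv.Perm (Fin n), qfac mm σ *
      ∫ y in openSimplex n, logIntegrand (fun i => m (σ⁻¹ i)) (fun i j => mm (σ⁻¹ i) (σ⁻¹ j))
        (fun i => 2 * Real.pi * Complex.I * y i) := by
  rw [Fminus_eq_integral hmm hfrac, integral_eq_sum_perm _ (measurableSet_unitCube n) _
    (integrableOn_circleIntegrand m hmm)]
  refine Finset.sum_congr rfl fun σ _ => ?_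
  have hset : {y : Fin n → ℝ | StrictMono y ∧ (fun i => y (σ i)) ∈ unitCube n} =
      openSimplex n := by
    ext y
    refine and_congr_right fun _ => ⟨fun h i _ => ?_, fun h i _ => h _ trivial⟩
    simpa using h (σ⁻¹ i) trivial
  rw [hset, ← integral_const_mul]
  exact setIntegral_congr_fun (measurableSet_openSimplex n) fun y hy =>
    circleIntegrand_perm m hsymm σ hy

theorem differentiableOn_integral_of_bounded {α : Type*} [MeasurableSpace α] {μ : Measure α}
    [IsFiniteMeasure μ] {F : ℂ → α → ℂ} {U : Set ℂ} (hU : IsOpen U)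
    (hmeas : ∀ s ∈ U, AEStronglyMeasurable (F s) μ)
    (hdiff : ∀ᵐ a ∂μ, DifferentiableOn ℂ (fun s => F s a) U)
    (hbd : ∀ R : ℝ, ∃ C : ℝ, ∀ᵐ a ∂μ, ∀ s ∈ U, ‖s‖ ≤ R → ‖F s a‖ ≤ C) :
    DifferentiableOn ℂ (fun s => ∫ a, F s a ∂μ) U := by
  intro s₀ hs₀
  obtain ⟨ε, hε, hball⟩ := Metric.isOpen_iff.1 hU s₀ hs₀
  obtain ⟨C, hC⟩ := hbd (‖s₀‖ + ε)
  have hr : 0 < ε / 3 := by positivity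
  have hsub : ∀ x ∈ Metric.ball s₀ (ε / 3), Metric.closedBall x (ε / 3) ⊆ Metric.ball s₀ ε := by
    intro x hx y hy
    rw [Metric.mem_ball] at hx ⊢
    rw [Metric.mem_closedBall] at hy
    linarith [dist_triangle y x s₀]
  have hnorm : ∀ x ∈ Metric.ball s₀ ε, ‖x‖ ≤ ‖s₀‖ + ε := by
    intro x hx
    rw [mem_ball_iff_norm] at hx
    linarith [norm_le_norm_add_norm_sub' x s₀]
  have hmeas' : AEStronglyMeasurable (fun a => deriv (fun s => F s a) s₀) μ := by
    have hv : ∀ k : ℕ, s₀ + ((ε / 2 * (1 / ((k : ℝ) + 1)) : ℝ) : ℂ) ∈ U := by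
      intro k
      apply hball
      rw [mem_ball_iff_norm, add_sub_cancel_left, Complex.norm_real, Real.norm_eq_abs,
        abs_of_pos (by positivity)]
      have : 1 / ((k : ℝ) + 1) ≤ 1 := by
        rw [div_le_one (by positivity)]
        linarith [k.cast_nonneg (α := ℝ)]
      nlinarith
    have hlim : Filter.Tendsto (fun k : ℕ => s₀ + ((ε / 2 * (1 / ((k : ℝ) + 1)) : ℝ) : ℂ))
        Filter.atTop (nhdsWithin s₀ {s₀}ᶜ) := by
      rw [tendsto_nhdsWithin_iff]
      refine ⟨?_, Filter.Eventually.of_forall fun k => ?_⟩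
      · have h := (tendsto_one_div_add_atTop_nhds_zero_nat (𝕜 := ℝ)).const_mul (ε / 2)
        have h2 := (Complex.continuous_ofReal.tendsto _).comp h
        simpa using h2.const_add s₀
      · have : (ε / 2 * (1 / ((k : ℝ) + 1)) : ℝ) ≠ 0 := by positivity
        simpa only [Set.mem_compl_iff, Set.mem_singleton_iff, add_eq_left,
          Complex.ofReal_eq_zero] using this
    refine aestronglyMeasurable_of_tendsto_ae Filter.atTop
      (f := fun (k : ℕ) a => slope (fun s => F s a) s₀
        (s₀ + ((ε / 2 * (1 / ((k : ℝ) + 1)) : ℝ) : ℂ))) (fun k => ?_) ?_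
    · simp only [slope, vsub_eq_sub]
      exact ((hmeas _ (hv k)).sub (hmeas _ hs₀)).const_smul (_ : ℂ)
    · filter_upwards [hdiff] with a ha
      exact (hasDerivAt_iff_tendsto_slope.1
        ((ha.differentiableAt (hU.mem_nhds hs₀)).hasDerivAt)).comp hlim
  have key := hasDerivAt_integral_of_dominated_loc_of_deriv_le (μ := μ) (F := F)
    (F' := fun s a => deriv (fun s => F s a) s) (x₀ := s₀) (bound := fun _ => C / (ε / 3))
    (Metric.ball_mem_nhds s₀ hr)
    (Filter.eventually_of_mem (hU.mem_nhds hs₀) hmeas) ?_ hmeas' ?_ (integrable_const _) ?_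
  · exact key.2.differentiableAt.differentiableWithinAt
  · refine Integrable.of_bound (hmeas s₀ hs₀) C ?_
    filter_upwards [hC] with a ha
    exact ha s₀ hs₀ (by linarith)
  · filter_upwards [hC, hdiff] with a ha hd x hx
    refine Complex.norm_deriv_le_of_forall_mem_sphere_norm_le hr ?_ fun z hz => ?_
    · refine DifferentiableOn.diffContOnCl (hd.mono ?_)
      rw [closure_ball _ hr.ne']
      exact (hsub x hx).trans hball
    · have hz' := hsub x hx (Metric.sphere_subset_closedBall hz)
      exact ha z (hball hz') (hnorm z hz')
  · filter_upwards [hdiff] with a ha x hx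
    exact (ha.differentiableAt (hU.mem_nhds (hball
      (Metric.ball_subset_ball (by linarith) hx)))).hasDerivAt

theorem norm_pairBranch (m : ℝ) (a b : ℂ) :
    ‖pairBranch m a b‖ = ‖Complex.exp b - Complex.exp a‖ ^ m := by
  have h1 : Complex.exp b - Complex.exp a =
      Complex.exp ((a + b) / 2) * (2 * Complex.sinh ((b - a) / 2)) := by
    rw [Complex.two_sinh, mul_sub, ← Complex.exp_add, ← Complex.exp_add]
    ring_nf
  have h2 : ‖-2 * Complex.I * Complex.sinh ((b - a) / 2)‖ = ‖2 * Complex.sinh ((b - a) / 2)‖ := by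
    simp
  rw [pairBranch, norm_mul, Complex.norm_cpow_real, h2, h1, norm_mul (Complex.exp ((a + b) / 2)),
    Real.mul_rpow (norm_nonneg _) (norm_nonneg _), Complex.norm_exp, Complex.norm_exp,
    ← Real.exp_mul]
  congr 2
  have : (m * (a + b) / 2 - Real.pi * Complex.I * m / 2 : ℂ) =
      (m : ℂ) * ((a + b) / 2 - Real.pi * Complex.I / 2) := by ring
  rw [this, Complex.re_ofReal_mul, mul_comm]
  simp

theorem norm_pairBranch_le {m M : ℝ} (hm : 0 ≤ m) {a b : ℂ} (ha : a.re ≤ M) (hb : b.re ≤ M) :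
    ‖pairBranch m a b‖ ≤ (2 * Real.exp M) ^ m := by
  rw [norm_pairBranch]
  refine Real.rpow_le_rpow (norm_nonneg _) ((norm_sub_le _ _).trans ?_) hm
  rw [Complex.norm_exp, Complex.norm_exp, two_mul]
  exact add_le_add (Real.exp_le_exp.2 hb) (Real.exp_le_exp.2 ha)

theorem norm_logIntegrand_le {n : ℕ} (m : Fin n → ℝ) {mm : Fin n → Fin n → ℝ}
    (hmm : ∀ i j : Fin n, i < j → 0 ≤ mm i j) {w : Fin n → ℂ} {M : ℝ} (hw : ∀ i, (w i).re ≤ M) :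
    ‖logIntegrand m mm w‖ ≤ (∏ i, Real.exp ((w i).re * (m i + 1))) *
      ∏ p : UT n, (2 * Real.exp M) ^ mm p.1.1 p.1.2 := by
  rw [logIntegrand, norm_mul, norm_prod, norm_prod]
  refine mul_le_mul (le_of_eq ?_) (Finset.prod_le_prod (fun _ _ => norm_nonneg _) fun p _ =>
    norm_pairBranch_le (hmm _ _ p.2) (hw _) (hw _)) (by positivity) (by positivity)
  refine Finset.prod_congr rfl fun i _ => ?_
  rw [Complex.norm_exp]
  congr 1
  simp

theorem sinh_mem_slitPlane {u : ℂ} (h0 : 0 < u.im) (h1 : u.im < Real.pi) :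
    -2 * Complex.I * Complex.sinh u ∈ Complex.slitPlane := by
  left
  have h2 : (-2 * Complex.I * Complex.sinh u).re = 2 * (Complex.sinh u).im := by
    simp [Complex.mul_re]
  have h3 : (Complex.sinh u).im = Real.cosh u.re * Real.sin u.im := by
    conv_lhs => rw [← Complex.re_add_im u, Complex.sinh_add, Complex.sinh_mul_I,
      Complex.cosh_mul_I]
    simp [Complex.sin_ofReal_re]
  rw [h2, h3]
  have := Real.sin_pos_of_pos_of_lt_pi h0 h1
  have := Real.cosh_pos u.re
  positivity

/-- A family of paths from `0` to `2πi`, deforming the segment for `s = 0` into the half-plane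
`Re < 0` for `s > 0`. -/
noncomputable def logPath (s : ℂ) (t : ℝ) : ℂ := 2 * Real.pi * Complex.I * t - s * (t * (1 - t))

/-- The velocity of `logPath`. -/
noncomputable def logPathDeriv (s : ℂ) (t : ℝ) : ℂ := 2 * Real.pi * Complex.I - s * (1 - 2 * t)

/-- The integral of the logarithmic form along a product of paths `logPath s`. -/
noncomputable def pathIntegral {n : ℕ} (m : Fin n → ℝ) (mm : Fin n → Fin n → ℝ) (s : ℂ) : ℂ :=
  ∫ t in openSimplex n, logIntegrand m mm (fun i => logPath s (t i)) * ∏ i, logPathDeriv s (t i)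

theorem measurable_logIntegrand {n : ℕ} (m : Fin n → ℝ) (mm : Fin n → Fin n → ℝ) :
    Measurable (logIntegrand m mm) := by
  unfold logIntegrand pairBranch
  simp only [Complex.sinh]
  fun_prop

theorem measurable_logPath (s : ℂ) : Measurable (logPath s) := by
  unfold logPath
  fun_prop

theorem measurable_logPathDeriv (s : ℂ) : Measurable (logPathDeriv s) := by
  unfold logPathDeriv
  fun_prop

theorem logPath_re (s : ℂ) (t : ℝ) : (logPath s t).re = -(s.re * (t * (1 - t))) := by
  have : logPath s t = ((2 * Real.pi * t : ℝ) : ℂ) * Complex.I - s * ((t * (1 - t) : ℝ) : ℂ) := by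
    rw [logPath]
    push_cast
    ring
  rw [this, Complex.sub_re, Complex.re_mul_ofReal, Complex.re_ofReal_mul]
  simp

theorem logPath_im (s : ℂ) (t : ℝ) :
    (logPath s t).im = 2 * Real.pi * t - s.im * (t * (1 - t)) := by
  have : logPath s t = ((2 * Real.pi * t : ℝ) : ℂ) * Complex.I - s * ((t * (1 - t) : ℝ) : ℂ) := by
    rw [logPath]
    push_cast
    ring
  rw [this, Complex.sub_im, Complex.im_mul_ofReal, Complex.im_ofReal_mul]
  simp

theorem logPath_sub_mem_slitPlane {s : ℂ} (hs : |s.im| < 2 * Real.pi) {a b : ℝ}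
    (ha : a ∈ Set.Ioo (0 : ℝ) 1) (hb : b ∈ Set.Ioo (0 : ℝ) 1) (hab : a < b) :
    -2 * Complex.I * Complex.sinh ((logPath s b - logPath s a) / 2) ∈ Complex.slitPlane := by
  obtain ⟨h1, h2⟩ := abs_lt.1 hs
  obtain ⟨ha0, ha1⟩ := ha
  obtain ⟨hb0, hb1⟩ := hb
  have hpi := Real.pi_pos
  have him : ((logPath s b - logPath s a) / 2).im =
      (b - a) * ((2 * Real.pi - s.im) * (1 - a - b) / 2 + Real.pi * (a + b)) := by
    rw [show (logPath s b - logPath s a) / 2 = (logPath s b - logPath s a) * ((1 / 2 : ℝ) : ℂ) by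
      push_cast; ring, Complex.im_mul_ofReal, Complex.sub_im, logPath_im, logPath_im]
    ring
  have hlow : 0 < (2 * Real.pi - s.im) * (1 - a - b) / 2 + Real.pi * (a + b) := by
    rcases le_total (a + b) 1 with h | h <;> nlinarith
  apply sinh_mem_slitPlane
  · rw [him]
    exact mul_pos (by linarith) hlow
  · rw [him]
    rcases le_total (a + b) 1 with h | h
    · have e1 : (2 * Real.pi - s.im) * (1 - a - b) / 2 + Real.pi * (a + b) ≤
        Real.pi * (2 - a - b) := by nlinarith
      have e2 := mul_le_mul_of_nonneg_left e1 (by linarith : 0 ≤ b - a)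
      have e3 : (b - a) * (2 - a - b) < 1 := by nlinarith
      nlinarith
    · have e1 : (2 * Real.pi - s.im) * (1 - a - b) / 2 + Real.pi * (a + b) ≤
        Real.pi * (a + b) := by nlinarith
      have e2 := mul_le_mul_of_nonneg_left e1 (by linarith : 0 ≤ b - a)
      have e3 : (b - a) * (a + b) < 1 := by nlinarith
      nlinarith

theorem volume_openSimplex_lt_top (n : ℕ) : volume (openSimplex n) < ⊤ := by
  refine (measure_mono (Set.inter_subset_right : _ ⊆ unitCube n)).trans_lt ?_
  rw [volume_unitCube]
  simp

theorem measurable_pathIntegrand {n : ℕ} (m : Fin n → ℝ) (mm : Fin n → Fin n → ℝ) (s : ℂ) :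
    Measurable fun t : Fin n → ℝ =>
      logIntegrand m mm (fun i => logPath s (t i)) * ∏ i, logPathDeriv s (t i) := by
  refine Measurable.mul ?_ ?_
  · exact (measurable_logIntegrand m mm).comp
      (measurable_pi_lambda _ fun i => (measurable_logPath s).comp (measurable_pi_apply i))
  · exact Finset.measurable_prod _ fun i _ =>
      (measurable_logPathDeriv s).comp (measurable_pi_apply i)

theorem norm_logPathDeriv_le (s : ℂ) {t : ℝ} (ht : t ∈ Set.Ioo (0 : ℝ) 1) :
    ‖logPathDeriv s t‖ ≤ 2 * Real.pi + ‖s‖ := by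
  obtain ⟨h0, h1⟩ := ht
  refine (norm_sub_le _ _).trans (add_le_add (le_of_eq ?_) ?_)
  · simp [abs_of_pos Real.pi_pos]
  · rw [norm_mul]
    have : ‖(1 - 2 * (t : ℂ))‖ ≤ 1 := by
      rw [show (1 - 2 * (t : ℂ)) = ((1 - 2 * t : ℝ) : ℂ) by push_cast; ring,
        Complex.norm_real, Real.norm_eq_abs, abs_le]
      constructor <;> linarith
    exact mul_le_of_le_one_right (norm_nonneg _) this

theorem norm_pathIntegrand_le {n : ℕ} {m : Fin n → ℝ} (hm : ∀ i, 0 ≤ m i)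
    {mm : Fin n → Fin n → ℝ} (hmm : ∀ i j : Fin n, i < j → 0 ≤ mm i j) {s : ℂ} {R : ℝ}
    (hs : ‖s‖ ≤ R) {t : Fin n → ℝ} (ht : t ∈ openSimplex n) :
    ‖logIntegrand m mm (fun i => logPath s (t i)) * ∏ i, logPathDeriv s (t i)‖ ≤
      ((∏ i, Real.exp (R * (m i + 1))) * ∏ p : UT n, (2 * Real.exp R) ^ mm p.1.1 p.1.2) *
        ∏ _i : Fin n, (2 * Real.pi + R) := by
  have hR : 0 ≤ R := (norm_nonneg s).trans hs
  have hre : ∀ i, (logPath s (t i)).re ≤ R := by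
    intro i
    obtain ⟨h0, h1⟩ := ht.2 i trivial
    have h2 := (abs_le.1 ((Complex.abs_re_le_norm s).trans hs)).1
    have h3 : t i * (1 - t i) ≤ 1 := by nlinarith
    have h4 : 0 < t i * (1 - t i) := mul_pos h0 (by linarith)
    rw [logPath_re]
    nlinarith
  rw [norm_mul]
  refine mul_le_mul ((norm_logIntegrand_le m hmm hre).trans ?_) ?_ (norm_nonneg _)
    (by positivity)
  · refine mul_le_mul_of_nonneg_right (Finset.prod_le_prod (fun _ _ => by positivity)
      fun i _ => Real.exp_le_exp.2 ?_) (by positivity)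
    exact mul_le_mul_of_nonneg_right (hre i) (by linarith [hm i])
  · rw [norm_prod]
    exact Finset.prod_le_prod (fun _ _ => norm_nonneg _) fun i _ =>
      (norm_logPathDeriv_le s (ht.2 i trivial)).trans (by linarith)

theorem differentiableOn_pathIntegral {n : ℕ} {m : Fin n → ℝ} (hm : ∀ i, 0 ≤ m i)
    {mm : Fin n → Fin n → ℝ} (hmm : ∀ i j : Fin n, i < j → 0 ≤ mm i j) :
    DifferentiableOn ℂ (pathIntegral m mm) {s : ℂ | |s.im| < 2 * Real.pi} := by
  have : IsFiniteMeasure (volume.restrict (openSimplex n)) := ⟨by simpa using volume_openSimplex_lt_top n⟩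
  refine differentiableOn_integral_of_bounded
    (isOpen_lt (continuous_abs.comp Complex.continuous_im) continuous_const) (fun s _ => ?_) ?_
    fun R => ?_
  · exact (measurable_pathIntegrand m mm s).aestronglyMeasurable
  · filter_upwards [ae_restrict_mem (measurableSet_openSimplex n)] with t ht s hs
    have hp : ∀ i, DifferentiableAt ℂ (fun s => logPath s (t i)) s := by
      intro i
      unfold logPath
      fun_prop
    have hq : ∀ i, DifferentiableAt ℂ (fun s => logPathDeriv s (t i)) s := by
      intro i
      unfold logPathDeriv
      fun_prop
    refine DifferentiableAt.differentiableWithinAt (DifferentiableAt.mul ?_ ?_)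
    · refine DifferentiableAt.mul ?_ ?_
      · exact DifferentiableAt.fun_finsetProd fun i _ => ((hp i).mul_const _).cexp
      · refine DifferentiableAt.fun_finsetProd fun p _ => DifferentiableAt.mul ?_ ?_
        · have h1 := hp p.1.1
          have h2 := hp p.1.2
          fun_prop
        · refine DifferentiableAt.cpow_const ?_ ?_
          · exact (((hp _).sub (hp _)).div_const 2).csinh.const_mul _
          · exact logPath_sub_mem_slitPlane hs (ht.2 _ trivial) (ht.2 _ trivial) (ht.1 p.2)
    · exact DifferentiableAt.fun_finsetProd fun i _ => hq i
  · refine ⟨((∏ i, Real.exp (R * (m i + 1))) * ∏ p : UT n, (2 * Real.exp R) ^ mm p.1.1 p.1.2) *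
      ∏ _i : Fin n, (2 * Real.pi + R), ?_⟩
    filter_upwards [ae_restrict_mem (measurableSet_openSimplex n)] with t ht s _ hsR
    exact norm_pathIntegrand_le hm hmm hsR ht

theorem pathIntegral_zero {n : ℕ} (m : Fin n → ℝ) (mm : Fin n → Fin n → ℝ) :
    pathIntegral m mm 0 = (2 * Real.pi * Complex.I) ^ n *
      ∫ y in openSimplex n, logIntegrand m mm (fun i => 2 * Real.pi * Complex.I * y i) := by
  rw [pathIntegral, ← integral_const_mul]
  refine integral_congr_ae (Filter.Eventually.of_forall fun y => ?_)
  simp [logPath, logPathDeriv, mul_comm]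

theorem pathIntegral_mul_I {n : ℕ} (m : Fin n → ℝ) (mm : Fin n → Fin n → ℝ) {τ : ℝ}
    (hτ : |τ| < 2 * Real.pi) :
    pathIntegral m mm (τ * Complex.I) = pathIntegral m mm 0 := by
  have hpi := Real.pi_pos
  obtain ⟨c, rfl⟩ : ∃ c, τ = 2 * Real.pi * c := ⟨τ / (2 * Real.pi), by field_simp⟩
  have hc : |c| < 1 := by
    rw [abs_mul, abs_of_pos (by positivity)] at hτ
    nlinarith
  obtain ⟨hc1, hc2⟩ := abs_lt.1 hc
  let ψ : ℝ → ℝ := fun t => t - c * (t * (1 - t))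
  let ψ' : ℝ → ℝ := fun t => 1 - c * (1 - 2 * t)
  have hψd : ∀ t, HasDerivAt ψ (ψ' t) t := by
    intro t
    have h : HasDerivAt ψ (1 - c * (1 * (1 - t) + t * (0 - 1))) t := (hasDerivAt_id t).sub
      (((hasDerivAt_id t).mul ((hasDerivAt_const t (1 : ℝ)).sub (hasDerivAt_id t))).const_mul c)
    convert h using 1
    ring
  have hψ'pos : ∀ t ∈ Set.Ioo (0 : ℝ) 1, 0 < ψ' t := by
    intro t ht
    have h1 := ht.1
    have h2 := ht.2
    simp only [ψ']
    nlinarith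
  have hψmono : StrictMonoOn ψ (Set.Icc 0 1) := by
    intro a ha b hb hab
    have : 0 < (b - a) * (1 - c * (1 - a - b)) :=
      mul_pos (by linarith) (by nlinarith [ha.1, ha.2, hb.1, hb.2])
    simp only [ψ]
    nlinarith
  have hψ0 : ψ 0 = 0 := by simp [ψ]
  have hψ1 : ψ 1 = 1 := by simp [ψ]
  have hIoo : ∀ t ∈ Set.Ioo (0 : ℝ) 1, ψ t ∈ Set.Ioo (0 : ℝ) 1 := by
    intro t ht
    have h0 := hψmono ⟨le_rfl, zero_le_one⟩ ⟨ht.1.le, ht.2.le⟩ ht.1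
    have h1 := hψmono ⟨ht.1.le, ht.2.le⟩ ⟨zero_le_one, le_rfl⟩ ht.2
    rw [hψ0] at h0
    rw [hψ1] at h1
    exact ⟨h0, h1⟩
  have hsurj : Set.Ioo (0 : ℝ) 1 ⊆ ψ '' Set.Ioo 0 1 := by
    have := intermediate_value_Ioo (zero_le_one' ℝ)
      (f := ψ) (fun t _ => (hψd t).continuousAt.continuousWithinAt)
    rwa [hψ0, hψ1] at this
  have himage : (fun (x : Fin n → ℝ) i => ψ (x i)) '' openSimplex n = openSimplex n := by
    ext y
    constructor
    · rintro ⟨x, hx, rfl⟩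
      refine ⟨fun i j hij => hψmono (Set.Ioo_subset_Icc_self (hx.2 i trivial))
        (Set.Ioo_subset_Icc_self (hx.2 j trivial)) (hx.1 hij), fun i _ => hIoo _ (hx.2 i trivial)⟩
    · intro hy
      choose x hx hxy using fun i => hsurj (hy.2 i trivial)
      refine ⟨x, ⟨fun i j hij => ?_, fun i _ => hx i⟩, funext hxy⟩
      rw [← hψmono.lt_iff_lt (Set.Ioo_subset_Icc_self (hx i)) (Set.Ioo_subset_Icc_self (hx j)),
        hxy, hxy]
      exact hy.1 hij
  have key := integral_image_pi (fun _ => ψ) (fun _ => ψ') (openSimplex n)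
    (measurableSet_openSimplex n) (fun x _ i => hψd (x i))
    (fun x hx y hy i h => hψmono.injOn (Set.Ioo_subset_Icc_self (hx.2 i trivial))
      (Set.Ioo_subset_Icc_self (hy.2 i trivial)) h)
    (fun y => logIntegrand m mm (fun i => 2 * Real.pi * Complex.I * y i))
  rw [himage] at key
  rw [pathIntegral_zero, key, ← integral_const_mul, pathIntegral]
  refine setIntegral_congr_fun (measurableSet_openSimplex n) fun t ht => ?_
  have h1 : ∀ i, logPath ((2 * Real.pi * c : ℝ) * Complex.I) (t i) =
      2 * Real.pi * Complex.I * (ψ (t i) : ℝ) := by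
    intro i
    simp only [logPath, ψ]
    push_cast
    ring
  have h2 : ∀ i, logPathDeriv ((2 * Real.pi * c : ℝ) * Complex.I) (t i) =
      2 * Real.pi * Complex.I * ((|ψ' (t i)| : ℝ) : ℂ) := by
    intro i
    rw [abs_of_pos (hψ'pos _ (ht.2 i trivial))]
    simp only [logPathDeriv, ψ']
    push_cast
    ring
  simp only [h1, h2, Finset.prod_mul_distrib, Finset.prod_const, Finset.card_univ,
    Fintype.card_fin, Complex.real_smul, Complex.ofReal_prod]
  ring

theorem pathIntegral_eq_zero {n : ℕ} {m : Fin n → ℝ} (hm : ∀ i, 0 ≤ m i)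
    {mm : Fin n → Fin n → ℝ} (hmm : ∀ i j : Fin n, i < j → 0 ≤ mm i j) (R : ℝ) :
    pathIntegral m mm R = pathIntegral m mm 0 := by
  have hpi := Real.pi_pos
  let U : Set ℂ := {s : ℂ | |s.im| < 2 * Real.pi}
  have hopen : IsOpen U :=
    isOpen_lt (continuous_abs.comp Complex.continuous_im) continuous_const
  have hconv : Convex ℝ U := by
    have : U = Complex.imCLM ⁻¹' Set.Ioo (-(2 * Real.pi)) (2 * Real.pi) := by
      ext s
      simp [U, abs_lt]
    rw [this]
    exact (convex_Ioo _ _).is_linear_preimage Complex.imCLM.isLinear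
  have hEq : Set.EqOn (pathIntegral m mm) (fun _ => pathIntegral m mm 0) U := by
    refine ((differentiableOn_pathIntegral hm hmm).analyticOnNhd
      hopen).eqOn_of_preconnected_of_frequently_eq analyticOnNhd_const hconv.isPreconnected
      (z₀ := 0) (by simp [hpi]) ?_
    have hlim : Filter.Tendsto (fun k : ℕ => ((1 / ((k : ℝ) + 1) : ℝ) : ℂ) * Complex.I)
        Filter.atTop (nhdsWithin 0 {0}ᶜ) := by
      rw [tendsto_nhdsWithin_iff]
      refine ⟨?_, Filter.Eventually.of_forall fun k => ?_⟩
      · have h2 := (Complex.continuous_ofReal.tendsto _).comp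
          (tendsto_one_div_add_atTop_nhds_zero_nat (𝕜 := ℝ))
        simpa using h2.mul_const Complex.I
      · have : (1 / ((k : ℝ) + 1) : ℝ) ≠ 0 := by positivity
        simpa only [Set.mem_compl_iff, Set.mem_singleton_iff, mul_eq_zero, Complex.I_ne_zero,
          or_false, Complex.ofReal_eq_zero] using this
    refine hlim.frequently (Filter.Frequently.of_forall fun k => pathIntegral_mul_I m mm ?_)
    rw [abs_of_pos (by positivity)]
    have : 1 / ((k : ℝ) + 1) ≤ 1 := by
      rw [div_le_one (by positivity)]
      linarith [k.cast_nonneg (α := ℝ)]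
    linarith [Real.pi_gt_three]
  exact hEq (by simp [U, hpi])

/-- The part of the open simplex whose first `k` coordinates are exactly those below `1/2`. -/
def cutSimplex (n k : ℕ) : Set (Fin n → ℝ) :=
  {t | t ∈ openSimplex n ∧ ∀ i : Fin n, t i < 1 / 2 ↔ (i : ℕ) < k}

theorem measurableSet_cutSimplex (n k : ℕ) : MeasurableSet (cutSimplex n k) := by
  have : cutSimplex n k = openSimplex n ∩
      ⋂ i : Fin n, {t : Fin n → ℝ | t i < 1 / 2 ↔ (i : ℕ) < k} := by
    ext
    simp [cutSimplex]
  rw [this]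
  refine (measurableSet_openSimplex n).inter (MeasurableSet.iInter fun i => ?_)
  exact (measurableSet_lt (measurable_pi_apply i) measurable_const).iff (MeasurableSet.const _)

theorem openSimplex_eq_iUnion (n : ℕ) :
    openSimplex n = ⋃ k ∈ Finset.range (n + 1), cutSimplex n k := by
  ext t
  simp only [Set.mem_iUnion, exists_prop]
  refine ⟨fun ht => ?_, fun ⟨k, _, ht⟩ => ht.1⟩
  have hex : ∃ k : ℕ, ∀ i : Fin n, k ≤ (i : ℕ) → 1 / 2 ≤ t i :=
    ⟨n, fun i hi => absurd i.2 hi.not_gt⟩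
  have hle : Nat.find hex ≤ n := Nat.find_min' hex fun i hi => absurd i.2 hi.not_gt
  refine ⟨Nat.find hex, Finset.mem_range.2 (Nat.lt_succ_of_le hle), ht, fun i => ⟨fun h => ?_,
    fun h => ?_⟩⟩
  · by_contra! hi
    exact (Nat.find_spec hex i hi).not_gt h
  · obtain ⟨j, hj⟩ : ∃ j, Nat.find hex = j + 1 := ⟨Nat.find hex - 1, by omega⟩
    have hmin := Nat.find_min hex (m := j) (by omega)
    push Not at hmin
    obtain ⟨i', hi', hlt⟩ := hmin
    refine lt_of_le_of_lt (ht.1.monotone ?_) hlt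
    rw [Fin.le_def]
    omega

theorem integral_openSimplex_eq_sum {n : ℕ} {f : (Fin n → ℝ) → ℂ}
    (hf : IntegrableOn f (openSimplex n)) :
    ∫ t in openSimplex n, f t = ∑ k ∈ Finset.range (n + 1), ∫ t in cutSimplex n k, f t := by
  have hsub : ∀ k, cutSimplex n k ⊆ openSimplex n := fun k t ht => ht.1
  rw [openSimplex_eq_iUnion]
  refine integral_biUnion_finset _ (fun k _ => measurableSet_cutSimplex n k) ?_
    fun k _ => hf.mono_set (hsub k)
  have hdisj : ∀ k l : ℕ, k < l → l < n + 1 → Disjoint (cutSimplex n k) (cutSimplex n l) := by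
    intro k l hkl hl
    rw [Set.disjoint_left]
    intro t h1 h2
    have h3 := (h1.2 ⟨k, by omega⟩).1 ((h2.2 ⟨k, by omega⟩).2 hkl)
    simp at h3
  intro k hk l hl hkl
  rw [Finset.mem_coe, Finset.mem_range] at hk hl
  rcases lt_or_gt_of_ne hkl with h | h
  · exact hdisj k l h hl
  · exact (hdisj l k h hk).symm

/-- The coordinate near the end of `[0, 1]` selected by `i < k`, rescaled by `R`. -/
noncomputable def endCoord (k : ℕ) (R : ℝ) {n : ℕ} (i : Fin n) (x : ℝ) : ℝ :=
  if (i : ℕ) < k then x / R else 1 - x / R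

theorem integral_cutSimplex {n : ℕ} (k : ℕ) {R : ℝ} (hR : 0 < R) (g : (Fin n → ℝ) → ℂ) :
    ∫ t in cutSimplex n k, g t =
      ∫ x in {x : Fin n → ℝ | (fun i => endCoord k R i (x i)) ∈ cutSimplex n k},
        (R : ℂ)⁻¹ ^ n * g (fun i => endCoord k R i (x i)) := by
  have hd : ∀ (i : Fin n) (x : ℝ), HasDerivAt (endCoord k R i)
      (if (i : ℕ) < k then R⁻¹ else -R⁻¹) x := by
    intro i x
    unfold endCoord
    split_ifs
    · simpa using (hasDerivAt_id x).div_const R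
    · simpa using ((hasDerivAt_id x).div_const R).const_sub 1
  have hcont : Continuous fun (x : Fin n → ℝ) i => endCoord k R i (x i) :=
    continuous_pi fun i => (continuous_iff_continuousAt.2 fun x =>
      (hd i x).continuousAt).comp (continuous_apply i)
  have key := integral_image_pi (fun i => endCoord k R i)
    (fun i _ => if (i : ℕ) < k then R⁻¹ else -R⁻¹)
    {x : Fin n → ℝ | (fun i => endCoord k R i (x i)) ∈ cutSimplex n k}
    (hcont.measurable (measurableSet_cutSimplex n k)) (fun x _ i => hd i _) ?_ g
  · have himage : (fun (x : Fin n → ℝ) i => endCoord k R i (x i)) ''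
        {x : Fin n → ℝ | (fun i => endCoord k R i (x i)) ∈ cutSimplex n k} = cutSimplex n k := by
      refine Set.image_preimage_eq _ fun t => ⟨fun i => if (i : ℕ) < k then R * t i else
        R * (1 - t i), funext fun i => ?_⟩
      simp only [endCoord]
      split_ifs
      · field_simp
      · field_simp
        ring
    rw [himage] at key
    rw [key]
    refine integral_congr_ae (Filter.Eventually.of_forall fun x => ?_)
    have : ∀ i : Fin n, |if (i : ℕ) < k then R⁻¹ else -R⁻¹| = R⁻¹ := by
      intro i
      split_ifs
      · exact abs_of_pos (by positivity)
      · rw [abs_neg, abs_of_pos (by positivity)]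
    simp [this]
  · intro x _ y _ i h
    simp only [endCoord] at h
    split_ifs at h <;> field_simp at h <;> linarith

/-- The limit of the rescaled `cutSimplex n k`. -/
def cuspSet (n k : ℕ) : Set (Fin n → ℝ) :=
  {x | (∀ i, 0 < x i) ∧ (∀ i j : Fin n, i < j → (j : ℕ) < k → x i < x j) ∧
    ∀ i j : Fin n, i < j → k ≤ (i : ℕ) → x j < x i}

theorem measurableSet_cuspSet (n k : ℕ) : MeasurableSet (cuspSet n k) := by
  have : cuspSet n k = (⋂ i : Fin n, {x : Fin n → ℝ | 0 < x i}) ∩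
      ((⋂ (i : Fin n) (j : Fin n) (_ : i < j) (_ : (j : ℕ) < k), {x : Fin n → ℝ | x i < x j}) ∩
      ⋂ (i : Fin n) (j : Fin n) (_ : i < j) (_ : k ≤ (i : ℕ)), {x : Fin n → ℝ | x j < x i}) := by
    ext x
    simp [cuspSet]
  rw [this]
  refine MeasurableSet.inter (MeasurableSet.iInter fun i =>
    measurableSet_lt measurable_const (measurable_pi_apply i)) (MeasurableSet.inter ?_ ?_)
  · exact MeasurableSet.iInter fun i => MeasurableSet.iInter fun j => MeasurableSet.iInter fun _ =>
      MeasurableSet.iInter fun _ => measurableSet_lt (measurable_pi_apply i) (measurable_pi_apply j)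
  · exact MeasurableSet.iInter fun i => MeasurableSet.iInter fun j => MeasurableSet.iInter fun _ =>
      MeasurableSet.iInter fun _ => measurableSet_lt (measurable_pi_apply j) (measurable_pi_apply i)

theorem endCoord_mem_cutSimplex {n : ℕ} {k : ℕ} {R : ℝ} (hR : 0 < R) {x : Fin n → ℝ}
    (h : (fun i => endCoord k R i (x i)) ∈ cutSimplex n k) :
    x ∈ cuspSet n k ∧ ∀ i, x i ≤ R / 2 := by
  obtain ⟨⟨h1, h2⟩, h3⟩ := h
  have h4 : ∀ i, 0 < x i ∧ x i ≤ R / 2 := by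
    intro i
    have h5 := h2 i trivial
    have h6 := h3 i
    simp only [endCoord] at h5 h6
    split_ifs at h5 h6 with hk
    · have h7 := h6.2 hk
      rw [div_lt_iff₀ hR] at h7
      exact ⟨by have := h5.1; rwa [lt_div_iff₀ hR, zero_mul] at this, by linarith⟩
    · have h7 := not_lt.1 (mt h6.1 hk)
      have h8 : x i / R ≤ 1 / 2 := by linarith
      have h9 : 0 < x i / R := by linarith [h5.2]
      rw [div_le_iff₀ hR] at h8
      rw [lt_div_iff₀ hR, zero_mul] at h9
      exact ⟨h9, by linarith⟩
  refine ⟨⟨fun i => (h4 i).1, fun i j hij hj => ?_, fun i j hij hi => ?_⟩, fun i => (h4 i).2⟩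
  · have h5 := h1 hij
    have hi : (i : ℕ) < k := lt_trans hij hj
    simp only [endCoord, if_pos hi, if_pos hj] at h5
    exact (div_lt_div_iff_of_pos_right hR).1 h5
  · have h5 := h1 hij
    have hj : ¬ (j : ℕ) < k := not_lt.2 (hi.trans (Fin.le_def.1 hij.le))
    simp only [endCoord, if_neg (not_lt.2 hi), if_neg hj] at h5
    exact (div_lt_div_iff_of_pos_right hR).1 (by linarith)

theorem eventually_endCoord_mem_cutSimplex {n : ℕ} {k : ℕ} {x : Fin n → ℝ}
    (hx : x ∈ cuspSet n k) :
    ∀ᶠ R : ℝ in Filter.atTop, (fun i => endCoord k R i (x i)) ∈ cutSimplex n k := by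
  obtain ⟨h0, h1, h2⟩ := hx
  have hlt : ∀ᶠ R : ℝ in Filter.atTop, ∀ i, 2 * x i < R :=
    Filter.eventually_all.2 fun i => Filter.eventually_gt_atTop _
  filter_upwards [hlt, Filter.eventually_gt_atTop 0] with R hR hR0
  have hhalf : ∀ i, x i / R < 1 / 2 := fun i => by
    rw [div_lt_iff₀ hR0]
    linarith [hR i]
  have hpos : ∀ i, 0 < x i / R := fun i => div_pos (h0 i) hR0
  refine ⟨⟨fun i j hij => ?_, fun i _ => ?_⟩, fun i => ?_⟩
  · simp only [endCoord]
    have := hhalf i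
    have := hhalf j
    split_ifs with hi hj hj
    · exact (div_lt_div_iff_of_pos_right hR0).2 (h1 i j hij hj)
    · linarith
    · exact absurd (lt_trans (Fin.lt_def.1 hij) hj) hi
    · have := (div_lt_div_iff_of_pos_right hR0).2 (h2 i j hij (not_lt.1 hi))
      linarith
  · have := hhalf i
    have := hpos i
    simp only [endCoord]
    split_ifs
    · exact ⟨by linarith, by linarith⟩
    · exact ⟨by linarith, by linarith⟩
  · have := hhalf i
    simp only [endCoord]
    split_ifs with hi
    · simp only [hi, iff_true]
      linarith
    · simp only [hi, iff_false, not_lt]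
      linarith

theorem continuousAt_logIntegrand {n : ℕ} (m : Fin n → ℝ) (mm : Fin n → Fin n → ℝ)
    {w : Fin n → ℂ} (hw : ∀ p : UT n,
      -2 * Complex.I * Complex.sinh ((w p.1.2 - w p.1.1) / 2) ∈ Complex.slitPlane) :
    ContinuousAt (logIntegrand m mm) w := by
  have hc : ∀ i, ContinuousAt (fun w : Fin n → ℂ => w i) w := fun i => continuousAt_apply i w
  refine ContinuousAt.mul ?_ ?_
  · exact tendsto_finsetProd _ fun i _ => ((hc i).mul continuousAt_const).cexp
  · refine tendsto_finsetProd _ fun p _ => ContinuousAt.mul ?_ ?_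
    · have h1 := hc p.1.1
      have h2 := hc p.1.2
      fun_prop
    · refine ContinuousAt.cpow ?_ continuousAt_const (hw p)
      exact continuousAt_const.mul (Complex.continuous_sinh.continuousAt.comp
        (((hc _).sub (hc _)).div_const 2))

/-- The limit of `logPath R` at rescaled end coordinates. -/
noncomputable def cuspPoint (k : ℕ) {n : ℕ} (x : Fin n → ℝ) (i : Fin n) : ℂ :=
  (if (i : ℕ) < k then 0 else 2 * Real.pi * Complex.I) - x i

theorem cuspPoint_mem_slitPlane (k : ℕ) {n : ℕ} {x : Fin n → ℝ} (hx : Function.Injective x)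
    (p : UT n) : -2 * Complex.I * Complex.sinh ((cuspPoint k x p.1.2 - cuspPoint k x p.1.1) / 2) ∈
      Complex.slitPlane := by
  have hne : (x p.1.1 - x p.1.2) / 2 ≠ 0 := by
    have := hx.ne p.2.ne
    intro h
    apply this
    linarith
  have hs : Real.sinh ((x p.1.1 - x p.1.2) / 2) ≠ 0 := by
    rwa [Ne, Real.sinh_eq_zero]
  have h1 : ∀ u : ℝ, -2 * Complex.I * Complex.sinh u = ((-2 * Real.sinh u : ℝ) : ℂ) * Complex.I := by
    intro u
    push_cast
    ring
  have hp : (p.1.1 : ℕ) < (p.1.2 : ℕ) := p.2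
  right
  have h2 : (cuspPoint k x p.1.2 - cuspPoint k x p.1.1) / 2 =
      (((x p.1.1 - x p.1.2) / 2 : ℝ) : ℂ) ∨
      (cuspPoint k x p.1.2 - cuspPoint k x p.1.1) / 2 =
      (((x p.1.1 - x p.1.2) / 2 : ℝ) : ℂ) + Real.pi * Complex.I := by
    simp only [cuspPoint]
    split_ifs
    · left
      push_cast
      ring
    · omega
    · right
      push_cast
      ring
    · left
      push_cast
      ring
  rcases h2 with h2 | h2
  · rw [h2, h1, Complex.im_ofReal_mul]
    simpa using hs
  · rw [h2, Complex.sinh_add, Complex.sinh_mul_I, Complex.cosh_mul_I, Complex.sin_pi,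
      Complex.cos_pi, zero_mul, mul_zero, add_zero, mul_neg_one, mul_neg, h1, Complex.neg_im,
      Complex.im_ofReal_mul]
    simpa using hs

theorem integrableOn_pathIntegrand {n : ℕ} {m : Fin n → ℝ} (hm : ∀ i, 0 ≤ m i)
    {mm : Fin n → Fin n → ℝ} (hmm : ∀ i j : Fin n, i < j → 0 ≤ mm i j) (s : ℂ) :
    IntegrableOn (fun t : Fin n → ℝ =>
      logIntegrand m mm (fun i => logPath s (t i)) * ∏ i, logPathDeriv s (t i))
      (openSimplex n) := by
  refine Measure.integrableOn_of_bounded (volume_openSimplex_lt_top n).ne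
    (measurable_pathIntegrand m mm s).aestronglyMeasurable ?_
    (M := ((∏ i, Real.exp (‖s‖ * (m i + 1))) *
      ∏ p : UT n, (2 * Real.exp ‖s‖) ^ mm p.1.1 p.1.2) * ∏ _i : Fin n, (2 * Real.pi + ‖s‖))
  filter_upwards [ae_restrict_mem (measurableSet_openSimplex n)] with t ht
  exact norm_pathIntegrand_le hm hmm le_rfl ht

theorem norm_scaled_pathIntegrand_le {n : ℕ} {m : Fin n → ℝ} (hm : ∀ i, 0 ≤ m i)
    {mm : Fin n → Fin n → ℝ} (hmm : ∀ i j : Fin n, i < j → 0 ≤ mm i j) {k : ℕ} {R : ℝ}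
    (hR : 1 ≤ R) {x : Fin n → ℝ} (hx : (fun i => endCoord k R i (x i)) ∈ cutSimplex n k) :
    ‖(R : ℂ)⁻¹ ^ n * (logIntegrand m mm (fun i => logPath R (endCoord k R i (x i))) *
      ∏ i, logPathDeriv R (endCoord k R i (x i)))‖ ≤
    ((2 * Real.pi + 1) ^ n * ∏ p : UT n, 2 ^ mm p.1.1 p.1.2) * ∏ i, Real.exp (-(1 / 2) * x i) := by
  have hR0 : 0 < R := by linarith
  obtain ⟨hc, hle⟩ := endCoord_mem_cutSimplex hR0 hx
  have hre : ∀ i, (logPath R (endCoord k R i (x i))).re ≤ -(1 / 2) * x i := by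
    intro i
    rw [logPath_re, Complex.ofReal_re]
    have h1 : R * (endCoord k R i (x i) * (1 - endCoord k R i (x i))) = x i * (1 - x i / R) := by
      simp only [endCoord]
      split_ifs
      · field_simp
      · field_simp
        ring
    have h2 : x i / R ≤ 1 / 2 := by
      rw [div_le_iff₀ hR0]
      linarith [hle i]
    rw [h1]
    nlinarith [hc.1 i]
  have hre0 : ∀ i, (logPath R (endCoord k R i (x i))).re ≤ 0 := fun i => by
    linarith [hre i, hc.1 i]
  have h1 : ‖logIntegrand m mm (fun i => logPath R (endCoord k R i (x i)))‖ ≤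
      (∏ i, Real.exp (-(1 / 2) * x i)) * ∏ p : UT n, 2 ^ mm p.1.1 p.1.2 := by
    refine (norm_logIntegrand_le m hmm hre0).trans ?_
    rw [Real.exp_zero, mul_one]
    refine mul_le_mul_of_nonneg_right (Finset.prod_le_prod (fun _ _ => by positivity)
      fun i _ => Real.exp_le_exp.2 ?_) (by positivity)
    nlinarith [hm i, hre i, hre0 i]
  have h2 : ‖(R : ℂ)⁻¹ ^ n * ∏ i, logPathDeriv R (endCoord k R i (x i))‖ ≤
      (2 * Real.pi + 1) ^ n := by
    rw [norm_mul, norm_pow, norm_prod, norm_inv, Complex.norm_real, Real.norm_eq_abs,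
      abs_of_pos hR0]
    have h3 : ∀ i, ‖logPathDeriv R (endCoord k R i (x i))‖ ≤ (2 * Real.pi + 1) * R := by
      intro i
      have := norm_logPathDeriv_le (R : ℂ) (hx.1.2 i trivial)
      rw [Complex.norm_real, Real.norm_eq_abs, abs_of_pos hR0] at this
      nlinarith [Real.pi_pos]
    calc R⁻¹ ^ n * ∏ i, ‖logPathDeriv R (endCoord k R i (x i))‖
        ≤ R⁻¹ ^ n * ∏ _i : Fin n, ((2 * Real.pi + 1) * R) := by
          gcongr with i
          exact h3 i
      _ = (2 * Real.pi + 1) ^ n := by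
          rw [Finset.prod_const, Finset.card_univ, Fintype.card_fin, ← mul_pow]
          congr 1
          field_simp
  rw [mul_left_comm, norm_mul, mul_comm]
  refine (mul_le_mul h2 h1 (norm_nonneg _) (by positivity)).trans (le_of_eq (by ring))

theorem tendsto_scaled_pathIntegrand {n : ℕ} (m : Fin n → ℝ) (mm : Fin n → Fin n → ℝ) (k : ℕ)
    {x : Fin n → ℝ} (hx : Function.Injective x) :
    Filter.Tendsto (fun R : ℝ => (R : ℂ)⁻¹ ^ n *
      (logIntegrand m mm (fun i => logPath R (endCoord k R i (x i))) *
        ∏ i, logPathDeriv R (endCoord k R i (x i)))) Filter.atTop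
      (nhds ((∏ i : Fin n, if (i : ℕ) < k then (-1 : ℂ) else 1) *
        logIntegrand m mm (cuspPoint k x))) := by
  have hinv : Filter.Tendsto (fun R : ℝ => ((R⁻¹ : ℝ) : ℂ)) Filter.atTop (nhds 0) := by
    have h := (Complex.continuous_ofReal.tendsto 0).comp (tendsto_inv_atTop_zero (𝕜 := ℝ))
    rwa [Complex.ofReal_zero] at h
  have hne : ∀ᶠ R : ℝ in Filter.atTop, (R : ℂ) ≠ 0 := by
    filter_upwards [Filter.eventually_gt_atTop 0] with R hR
    exact_mod_cast hR.ne'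
  have h1 : Filter.Tendsto (fun (R : ℝ) i => logPath R (endCoord k R i (x i))) Filter.atTop
      (nhds (cuspPoint k x)) := by
    refine tendsto_pi_nhds.2 fun i => ?_
    let q : ℂ → ℂ := fun z => 2 * Real.pi * Complex.I *
      (if (i : ℕ) < k then x i * z else 1 - x i * z) - x i * (1 - x i * z)
    have hq : Continuous q := by
      simp only [q]
      split_ifs <;> fun_prop
    have hq0 : q 0 = cuspPoint k x i := by
      simp only [q, cuspPoint]
      split_ifs <;> simp
    rw [← hq0]
    refine ((hq.tendsto 0).comp hinv).congr' ?_
    filter_upwards [hne] with R hR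
    simp only [q, Function.comp, logPath, endCoord]
    split_ifs
    · push_cast
      field_simp
    · push_cast
      field_simp
      ring
  have h2 : Filter.Tendsto (fun R : ℝ => ∏ i, ((R : ℂ)⁻¹ * logPathDeriv R (endCoord k R i (x i))))
      Filter.atTop (nhds (∏ i : Fin n, if (i : ℕ) < k then (-1 : ℂ) else 1)) := by
    refine tendsto_finsetProd _ fun i _ => ?_
    let q : ℂ → ℂ := fun z => 2 * Real.pi * Complex.I * z -
      (1 - 2 * (if (i : ℕ) < k then x i * z else 1 - x i * z))
    have hq : Continuous q := by
      simp only [q]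
      split_ifs <;> fun_prop
    have hq0 : q 0 = if (i : ℕ) < k then (-1 : ℂ) else 1 := by
      simp only [q]
      split_ifs
      · simp
      · norm_num
    rw [← hq0]
    refine ((hq.tendsto 0).comp hinv).congr' ?_
    filter_upwards [hne] with R hR
    simp only [q, Function.comp, logPathDeriv, endCoord]
    split_ifs
    · push_cast
      field_simp
    · push_cast
      field_simp
  have h3 := (continuousAt_logIntegrand m mm (cuspPoint_mem_slitPlane k hx)).tendsto.comp h1
  refine (h2.mul h3).congr fun R => ?_
  rw [Finset.prod_mul_distrib, Finset.prod_const, Finset.card_univ, Fintype.card_fin,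
    Function.comp]
  ring

theorem tendsto_integral_cutSimplex {n : ℕ} {m : Fin n → ℝ} (hm : ∀ i, 0 ≤ m i)
    {mm : Fin n → Fin n → ℝ} (hmm : ∀ i j : Fin n, i < j → 0 ≤ mm i j) (k : ℕ) :
    Filter.Tendsto (fun R : ℝ => ∫ t in cutSimplex n k,
      logIntegrand m mm (fun i => logPath R (t i)) * ∏ i, logPathDeriv R (t i)) Filter.atTop
      (nhds ((∏ i : Fin n, if (i : ℕ) < k then (-1 : ℂ) else 1) *
        ∫ x in cuspSet n k, logIntegrand m mm (cuspPoint k x))) := by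
  have hcont : ∀ R : ℝ, Measurable fun (x : Fin n → ℝ) i => endCoord k R i (x i) := by
    intro R
    refine measurable_pi_lambda _ fun i => ?_
    simp only [endCoord]
    split_ifs <;> fun_prop
  rw [← integral_const_mul, ← integral_indicator (measurableSet_cuspSet n k)]
  have heq : ∀ᶠ R : ℝ in Filter.atTop, ∫ x, Set.indicator
      {x : Fin n → ℝ | (fun i => endCoord k R i (x i)) ∈ cutSimplex n k} (fun x => (R : ℂ)⁻¹ ^ n *
      (logIntegrand m mm (fun i => logPath R (endCoord k R i (x i))) *
        ∏ i, logPathDeriv R (endCoord k R i (x i)))) x = ∫ t in cutSimplex n k,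
      logIntegrand m mm (fun i => logPath R (t i)) * ∏ i, logPathDeriv R (t i) := by
    filter_upwards [Filter.eventually_gt_atTop 0] with R hR
    rw [integral_cutSimplex k hR]
    exact integral_indicator ((hcont R) (measurableSet_cutSimplex n k))
  refine Filter.Tendsto.congr' heq ?_
  refine tendsto_integral_filter_of_dominated_convergence
    (fun x : Fin n → ℝ => ((2 * Real.pi + 1) ^ n * ∏ p : UT n, 2 ^ mm p.1.1 p.1.2) *
      ∏ i, (Set.Ioi (0 : ℝ)).indicator (fun x => Real.exp (-(1 / 2) * x)) (x i))
    (Filter.Eventually.of_forall fun R => ?_) ?_ ?_ ?_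
  · exact ((((measurable_pathIntegrand m mm R).comp (hcont R)).const_mul _).indicator
      ((hcont R) (measurableSet_cutSimplex n k))).aestronglyMeasurable
  · filter_upwards [Filter.eventually_ge_atTop 1] with R hR
    refine Filter.Eventually.of_forall fun x => ?_
    by_cases hx : (fun i => endCoord k R i (x i)) ∈ cutSimplex n k
    · rw [Set.indicator_of_mem (by exact hx)]
      have hpos := (endCoord_mem_cutSimplex (by linarith) hx).1.1
      have h := norm_scaled_pathIntegrand_le hm hmm hR hx
      rwa [Finset.prod_congr rfl fun i _ => Set.indicator_of_mem (Set.mem_Ioi.2 (hpos i)) _]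
    · rw [Set.indicator_of_notMem (by exact hx), norm_zero]
      refine mul_nonneg (by positivity) (Finset.prod_nonneg fun i _ =>
        Set.indicator_nonneg (fun _ _ => by positivity) _)
  · refine Integrable.const_mul (Integrable.fintype_prod fun i => ?_) _
    exact (integrable_indicator_iff measurableSet_Ioi).2
      (exp_neg_integrableOn_Ioi 0 (by norm_num : (0 : ℝ) < 1 / 2))
  · filter_upwards [ae_injective n] with x hx
    by_cases hxc : x ∈ cuspSet n k
    · rw [Set.indicator_of_mem hxc]
      refine (tendsto_scaled_pathIntegrand m mm k hx).congr' ?_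
      filter_upwards [eventually_endCoord_mem_cutSimplex hxc] with R hR
      rw [Set.indicator_of_mem (by exact hR)]
    · rw [Set.indicator_of_notMem hxc]
      refine tendsto_const_nhds.congr' ?_
      filter_upwards [Filter.eventually_gt_atTop 0] with R hR
      rw [Set.indicator_of_notMem]
      exact fun h => hxc (endCoord_mem_cutSimplex hR h).1

theorem pathIntegral_zero_eq_sum {n : ℕ} {m : Fin n → ℝ} (hm : ∀ i, 0 ≤ m i)
    {mm : Fin n → Fin n → ℝ} (hmm : ∀ i j : Fin n, i < j → 0 ≤ mm i j) :
    pathIntegral m mm 0 = ∑ k ∈ Finset.range (n + 1), (-1 : ℂ) ^ k *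
        ∫ x in cuspSet n k, logIntegrand m mm (cuspPoint k x) := by
  have h := tendsto_finsetSum (Finset.range (n + 1)) fun k _ =>
    tendsto_integral_cutSimplex hm hmm k
  have h2 : (fun R : ℝ => ∑ k ∈ Finset.range (n + 1), ∫ t in cutSimplex n k,
      logIntegrand m mm (fun i => logPath R (t i)) * ∏ i, logPathDeriv R (t i)) =
      fun _ => pathIntegral m mm 0 := by
    funext R
    rw [← integral_openSimplex_eq_sum (integrableOn_pathIntegrand hm hmm R)]
    exact pathIntegral_eq_zero hm hmm R
  rw [h2] at h
  refine (tendsto_nhds_unique tendsto_const_nhds h).trans (Finset.sum_congr rfl fun k hk => ?_)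
  congr 1
  rw [Finset.prod_ite, Finset.prod_const, Finset.prod_const_one, mul_one]
  congr 1
  rw [Finset.mem_range] at hk
  rw [Fin.card_filter_val_lt]
  omega

theorem abs_exp_neg_sub_exp_neg (α β : ℝ) :
    |Real.exp (-α) - Real.exp (-β)| = 2 * Real.sinh (|α - β| / 2) * Real.exp (-(α + β) / 2) := by
  have h : ∀ a b : ℝ, a ≤ b →
      |Real.exp (-a) - Real.exp (-b)| = 2 * Real.sinh (|a - b| / 2) * Real.exp (-(a + b) / 2) := by
    intro a b hab
    rw [abs_of_nonneg (sub_nonneg.2 (Real.exp_le_exp.2 (neg_le_neg hab))),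
      abs_of_nonpos (sub_nonpos.2 hab), Real.sinh_eq, mul_div_cancel₀ _ two_ne_zero, sub_mul,
      ← Real.exp_add, ← Real.exp_add]
    ring_nf
  rcases le_total α β with hle | hle
  · exact h α β hle
  · rw [abs_sub_comm, abs_sub_comm α, add_comm]
    exact h β α hle

theorem pairBranch_of_eq_polar {a b : ℂ} {r θ : ℝ} (hr : 0 < r) (h1 : -Real.pi < θ)
    (h2 : θ ≤ Real.pi)
    (h : -2 * Complex.I * Complex.sinh ((b - a) / 2) = r * Complex.exp (θ * Complex.I)) (μ : ℝ) :
    pairBranch μ a b = ((r ^ μ : ℝ) : ℂ) *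
      Complex.exp (μ * ((a + b) / 2 + (θ - Real.pi / 2) * Complex.I)) := by
  rw [pairBranch, h, polar_cpow hr h1 h2, mul_left_comm, ← Complex.exp_add]
  congr 2
  ring

theorem pairBranch_cuspPoint {n k : ℕ} {x : Fin n → ℝ} (hinj : Function.Injective x)
    (hx : x ∈ cuspSet n k) (p : UT n) (μ : ℝ) :
    pairBranch μ (cuspPoint k x p.1.1) (cuspPoint k x p.1.2) =
      (if x p.1.2 < x p.1.1 then Complex.exp (Real.pi * Complex.I * μ) else 1) *
        ((|Real.exp (-x p.1.1) - Real.exp (-x p.1.2)| ^ μ : ℝ) : ℂ) := by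
  obtain ⟨⟨i, j⟩, hij⟩ := p
  change i < j at hij
  have hne : x i ≠ x j := hinj.ne hij.ne
  have hpi := Real.pi_pos
  set r := 2 * Real.sinh (|x i - x j| / 2) with hr_def
  have hr : 0 < r := by
    have : 0 < |x i - x j| := abs_pos.2 (sub_ne_zero.2 hne)
    have := Real.sinh_pos_iff.2 (half_pos this)
    positivity
  have hD : ((|Real.exp (-x i) - Real.exp (-x j)| ^ μ : ℝ) : ℂ) =
      ((r ^ μ : ℝ) : ℂ) * Complex.exp (μ * (-(x i + x j) / 2)) := by
    rw [abs_exp_neg_sub_exp_neg, Real.mul_rpow hr.le (Real.exp_pos _).le, ← Real.exp_mul]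
    push_cast
    congr 2
    ring
  have hexp : Complex.exp (-(Real.pi / 2 : ℝ) * Complex.I) = -Complex.I := by
    push_cast
    rw [neg_mul, Complex.exp_neg, Complex.exp_pi_div_two_mul_I, Complex.inv_I]
  have hexp' : Complex.exp ((Real.pi / 2 : ℝ) * Complex.I) = Complex.I := by
    push_cast
    exact Complex.exp_pi_div_two_mul_I
  rw [hD]
  simp only
  by_cases hi : (i : ℕ) < k <;> by_cases hj : (j : ℕ) < k
  · have hlt := hx.2.1 i j hij hj
    rw [pairBranch_of_eq_polar hr (θ := Real.pi / 2) (by linarith) (by linarith), if_neg hlt.not_gt,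
      one_mul]
    · congr 2
      simp only [cuspPoint, if_pos hi, if_pos hj]
      push_cast
      ring
    · rw [hexp', hr_def, abs_of_neg (sub_neg.2 hlt)]
      simp only [cuspPoint, if_pos hi, if_pos hj]
      rw [show (0 - (x j : ℂ) - (0 - x i)) / 2 = -(-(x i - x j) / 2) by ring, Complex.sinh_neg]
      push_cast
      ring
  · have hs : Complex.sinh ((cuspPoint k x j - cuspPoint k x i) / 2) =
        -Complex.sinh ((x i - x j) / 2) := by
      simp only [cuspPoint, if_pos hi, if_neg hj]
      rw [show (2 * Real.pi * Complex.I - (x j : ℂ) - (0 - x i)) / 2 =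
        (x i - x j) / 2 + Real.pi * Complex.I by ring, Complex.sinh_add, Complex.sinh_mul_I,
        Complex.cosh_mul_I, Complex.sin_pi, Complex.cos_pi]
      ring
    rcases lt_or_gt_of_ne hne with hlt | hlt
    · rw [pairBranch_of_eq_polar hr (θ := -(Real.pi / 2)) (by linarith) (by linarith),
        if_neg hlt.not_gt, one_mul]
      · congr 2
        simp only [cuspPoint, if_pos hi, if_neg hj]
        push_cast
        ring
      · rw [Complex.ofReal_neg, hexp, hr_def, abs_of_neg (sub_neg.2 hlt), hs, ← Complex.sinh_neg]
        push_cast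
        ring_nf
    · rw [pairBranch_of_eq_polar hr (θ := Real.pi / 2) (by linarith) (by linarith),
        if_pos hlt, mul_left_comm, ← Complex.exp_add]
      · congr 2
        simp only [cuspPoint, if_pos hi, if_neg hj]
        push_cast
        ring
      · rw [hexp', hr_def, abs_of_pos (sub_pos.2 hlt), hs]
        push_cast
        ring
  · exact absurd (lt_trans (Fin.lt_def.1 hij) hj) hi
  · have hlt := hx.2.2 i j hij (not_lt.1 hi)
    rw [pairBranch_of_eq_polar hr (θ := -(Real.pi / 2)) (by linarith) (by linarith), if_pos hlt,
      mul_left_comm, ← Complex.exp_add]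
    · congr 2
      simp only [cuspPoint, if_neg hi, if_neg hj]
      push_cast
      ring
    · rw [Complex.ofReal_neg, hexp, hr_def, abs_of_pos (sub_pos.2 hlt)]
      simp only [cuspPoint, if_neg hi, if_neg hj]
      push_cast
      ring_nf

/-- The Selberg integrand with `m̄ = 0` in the coordinates `z_i = exp (-x_i)`, without assuming
any ordering of the coordinates. -/
noncomputable def expIntegrand {n : ℕ} (m : Fin n → ℝ) (mm : Fin n → Fin n → ℝ)
    (x : Fin n → ℝ) : ℝ :=
  (∏ i, Real.exp (-x i * (m i + 1))) *
    ∏ p : UT n, |Real.exp (-x p.1.1) - Real.exp (-x p.1.2)| ^ mm p.1.1 p.1.2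

theorem logIntegrand_cuspPoint {n k : ℕ} (m : Fin n → ℝ) (mm : Fin n → Fin n → ℝ)
    {x : Fin n → ℝ} (hinj : Function.Injective x) (hx : x ∈ cuspSet n k) :
    logIntegrand m mm (cuspPoint k x) =
      (∏ i ∈ Finset.univ.filter (fun i : Fin n => k ≤ (i : ℕ)),
        Complex.exp (2 * Real.pi * Complex.I * (m i))) *
      (∏ p : UT n, if x p.1.2 < x p.1.1 then
        Complex.exp (Real.pi * Complex.I * mm p.1.1 p.1.2) else 1) *
      expIntegrand m mm x := by
  have h1 : ∀ i, Complex.exp (cuspPoint k x i * (m i + 1)) =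
      (if k ≤ (i : ℕ) then Complex.exp (2 * Real.pi * Complex.I * (m i)) else 1) *
        ((Real.exp (-x i * (m i + 1)) : ℝ) : ℂ) := by
    intro i
    simp only [cuspPoint]
    push_cast
    by_cases hi : (i : ℕ) < k
    · rw [if_pos hi, if_neg (not_le.2 hi), one_mul, zero_sub]
    · rw [if_neg hi, if_pos (not_lt.1 hi), ← Complex.exp_add,
        ← Complex.exp_periodic (2 * Real.pi * Complex.I * m i + -x i * (m i + 1))]
      congr 1
      ring
  rw [logIntegrand, Finset.prod_congr rfl fun i _ => h1 i,
    Finset.prod_congr rfl fun p _ => pairBranch_cuspPoint hinj hx p _, Finset.prod_mul_distrib,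
    Finset.prod_mul_distrib, expIntegrand, Finset.prod_filter]
  push_cast
  ring

theorem integrableOn_logIntegrand_cuspPoint {n : ℕ} {m : Fin n → ℝ} (hm : ∀ i, 0 ≤ m i)
    {mm : Fin n → Fin n → ℝ} (hmm : ∀ i j : Fin n, i < j → 0 ≤ mm i j) (k : ℕ) :
    IntegrableOn (fun x : Fin n → ℝ => logIntegrand m mm (cuspPoint k x)) (cuspSet n k) := by
  have hinteg : Integrable (fun x : Fin n → ℝ => (∏ p : UT n, 2 ^ mm p.1.1 p.1.2) *
      ∏ i, (Set.Ioi (0 : ℝ)).indicator (fun x => Real.exp (-1 * x)) (x i)) :=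
    Integrable.const_mul (Integrable.fintype_prod fun i =>
      (integrable_indicator_iff measurableSet_Ioi).2 (exp_neg_integrableOn_Ioi 0 one_pos)) _
  refine hinteg.integrableOn.mono' (Measurable.aestronglyMeasurable ?_) ?_
  · refine (measurable_logIntegrand m mm).comp (measurable_pi_lambda _ fun i => ?_)
    simp only [cuspPoint]
    fun_prop
  · filter_upwards [ae_restrict_mem (measurableSet_cuspSet n k)] with x hx
    have hre : ∀ i, (cuspPoint k x i).re = -x i := by
      intro i
      simp only [cuspPoint]
      split_ifs <;> simp
    refine (norm_logIntegrand_le m hmm (M := 0) fun i => ?_).trans ?_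
    · rw [hre]
      linarith [hx.1 i]
    · rw [Real.exp_zero, mul_one, mul_comm]
      refine mul_le_mul_of_nonneg_left (Finset.prod_le_prod (fun _ _ => by positivity)
        fun i _ => ?_) (by positivity)
      rw [Set.indicator_of_mem (Set.mem_Ioi.2 (hx.1 i)), Real.exp_le_exp, hre]
      nlinarith [hx.1 i, hm i]

theorem expIntegrand_perm {n : ℕ} (m : Fin n → ℝ) {mm : Fin n → Fin n → ℝ}
    (hsymm : ∀ i j, mm i j = mm j i) (η : Equiv.Perm (Fin n)) (y : Fin n → ℝ) :
    (expIntegrand m mm (fun i => y (η i)) : ℂ) =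
      expIntegrand (fun i => m (η⁻¹ i)) (fun i j => mm (η⁻¹ i) (η⁻¹ j)) y := by
  have h1 := prod_pairs_perm η (fun i j =>
    ((|Real.exp (-y i) - Real.exp (-y j)| ^ mm (η⁻¹ i) (η⁻¹ j) : ℝ) : ℂ)) (fun i j _ => by
      rw [abs_sub_comm, hsymm])
  simp only [Equiv.Perm.coe_inv, Equiv.symm_apply_apply] at h1
  have h2 : ∏ i, Real.exp (-y (η i) * (m i + 1)) = ∏ i, Real.exp (-y i * (m (η⁻¹ i) + 1)) := by
    rw [← Equiv.prod_comp η fun i => Real.exp (-y i * (m (η⁻¹ i) + 1))]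
    simp
  rw [expIntegrand, expIntegrand, Complex.ofReal_mul, Complex.ofReal_mul, h2,
    Complex.ofReal_prod Finset.univ fun p : UT n => _,
    Complex.ofReal_prod Finset.univ fun p : UT n => _, h1]
  rfl

/-- The chamber `0 < y₁ < ⋯ < yₙ`. -/
def expChamber (n : ℕ) : Set (Fin n → ℝ) := {y | StrictMono y ∧ ∀ i, 0 < y i}

theorem measurableSet_expChamber (n : ℕ) : MeasurableSet (expChamber n) := by
  have : expChamber n = {y : Fin n → ℝ | StrictMono y} ∩ ⋂ i, {y | 0 < y i} := by
    ext
    simp [expChamber]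
  rw [this]
  exact (measurableSet_strictMono n).inter (MeasurableSet.iInter fun i =>
    measurableSet_lt measurable_const (measurable_pi_apply i))

theorem strictMono_mem_cuspSet_iff {n k : ℕ} (η : Equiv.Perm (Fin n)) {y : Fin n → ℝ}
    (hy : StrictMono y) :
    (fun i => y (η i)) ∈ cuspSet n k ↔ (∀ i, 0 < y i) ∧ η ∈ SbarFinset n k := by
  simp only [cuspSet, SbarFinset, Set.mem_ofPred_eq, Finset.mem_filter, Finset.mem_univ, true_and,
    hy.lt_iff_lt]
  exact and_congr_left fun _ => η.forall_congr_left.trans (by simp)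

theorem image_exp_neg_expChamber (n : ℕ) :
    (fun (x : Fin n → ℝ) i => Real.exp (-x i)) '' expChamber n =
      {z | (∀ i, 0 < z i ∧ z i < 1) ∧ ∀ i j : Fin n, i < j → z j < z i} := by
  ext z
  constructor
  · rintro ⟨x, hx, rfl⟩
    refine ⟨fun i => ⟨Real.exp_pos _, ?_⟩, fun i j hij => ?_⟩
    · rw [Real.exp_lt_one_iff]
      linarith [hx.2 i]
    · exact Real.exp_lt_exp.2 (neg_lt_neg (hx.1 hij))
  · rintro ⟨h1, h2⟩
    refine ⟨fun i => -Real.log (z i), ⟨fun i j hij => ?_, fun i => ?_⟩, funext fun i => ?_⟩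
    · exact neg_lt_neg (Real.log_lt_log (h1 j).1 (h2 i j hij))
    · exact neg_pos.2 (Real.log_neg (h1 i).1 (h1 i).2)
    · change Real.exp (- -Real.log (z i)) = z i
      rw [neg_neg, Real.exp_log (h1 i).1]

theorem integral_expChamber {n : ℕ} (m : Fin n → ℝ) (mm : Fin n → Fin n → ℝ) :
    ∫ y in expChamber n, (expIntegrand m mm y : ℂ) = Sel n m (fun _ => 0) mm := by
  have hae : (simplexSet n : Set (Fin n → ℝ)) =ᵐ[volume]
      (fun (x : Fin n → ℝ) i => Real.exp (-x i)) '' expChamber n := by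
    rw [image_exp_neg_expChamber]
    have h0 : ∀ᵐ z : Fin n → ℝ, ∀ i, z i ≠ 0 :=
      ae_all_iff.2 fun i => Measure.ae_eval_ne (fun _ => volume) i 0
    have h1 : ∀ᵐ z : Fin n → ℝ, ∀ i, z i ≠ 1 :=
      ae_all_iff.2 fun i => Measure.ae_eval_ne (fun _ => volume) i 1
    filter_upwards [h0, h1] with z hz0 hz1
    refine propext (and_congr_left fun _ => forall_congr' fun i => ?_)
    exact and_congr (lt_iff_le_and_ne.trans (and_iff_left (hz0 i).symm)).symm
      (lt_iff_le_and_ne.trans (and_iff_left (hz1 i))).symm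
  rw [Sel, ← integral_complex_ofReal, setIntegral_congr_set hae,
    integral_image_pi (fun _ x => Real.exp (-x)) (fun _ x => -Real.exp (-x)) (expChamber n)
      (measurableSet_expChamber n) (fun x _ i => by simpa using (hasDerivAt_neg (x i)).exp)
      (fun x _ y _ i h => neg_injective (Real.exp_injective h))]
  refine setIntegral_congr_fun (measurableSet_expChamber n) fun y hy => ?_
  have h2 : ∀ p : UT n, |Real.exp (-y p.1.1) - Real.exp (-y p.1.2)| =
      Real.exp (-y p.1.1) - Real.exp (-y p.1.2) := fun p =>
    abs_of_nonneg (sub_nonneg.2 (Real.exp_le_exp.2 (neg_le_neg (hy.1 p.2).le)))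
  have h3 : ∀ i, Real.exp (-y i * (m i + 1)) = Real.exp (-y i) * Real.exp (-y i) ^ m i := by
    intro i
    rw [← Real.exp_mul, ← Real.exp_add]
    ring_nf
  simp only [expIntegrand, h2, h3, Finset.prod_mul_distrib, Real.rpow_zero, Finset.prod_const_one,
    mul_one, abs_neg, Real.abs_exp, Complex.real_smul]
  push_cast
  ring

theorem integral_cuspSet {n : ℕ} {m : Fin n → ℝ} (hm : ∀ i, 0 ≤ m i)
    {mm : Fin n → Fin n → ℝ} (hsymm : ∀ i j, mm i j = mm j i)
    (hmm : ∀ i j : Fin n, i < j → 0 ≤ mm i j) (k : ℕ) :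
    ∫ x in cuspSet n k, logIntegrand m mm (cuspPoint k x) =
      (∏ i ∈ Finset.univ.filter (fun i : Fin n => k ≤ (i : ℕ)),
        Complex.exp (2 * Real.pi * Complex.I * (m i))) *
      ∑ η ∈ SbarFinset n k,
        (∏ p : UT n, if η p.1.2 < η p.1.1 then
          Complex.exp (Real.pi * Complex.I * mm p.1.1 p.1.2) else 1) *
        (Sel n (fun i => m (η⁻¹ i)) (fun _ => 0) (fun i j => mm (η⁻¹ i) (η⁻¹ j)) : ℂ) := by
  rw [integral_eq_sum_perm _ (measurableSet_cuspSet n k) _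
    (integrableOn_logIntegrand_cuspPoint hm hmm k), Finset.mul_sum,
    ← Finset.sum_subset (Finset.subset_univ (SbarFinset n k))]
  · refine Finset.sum_congr rfl fun η hη => ?_
    have hset : {y : Fin n → ℝ | StrictMono y ∧ (fun i => y (η i)) ∈ cuspSet n k} =
        expChamber n := by
      ext y
      exact and_congr_right fun hy =>
        (strictMono_mem_cuspSet_iff η hy).trans (and_iff_left hη)
    rw [hset, ← integral_expChamber, ← mul_assoc, ← integral_const_mul]
    refine setIntegral_congr_fun (measurableSet_expChamber n) fun y hy => ?_
    rw [logIntegrand_cuspPoint (x := fun i => y (η i)) m mm (hy.1.injective.comp η.injective)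
      ((strictMono_mem_cuspSet_iff η hy.1).2 ⟨hy.2, hη⟩), expIntegrand_perm m hsymm]
    simp only [hy.1.lt_iff_lt]
  · intro η _ hη
    have hset : {y : Fin n → ℝ | StrictMono y ∧ (fun i => y (η i)) ∈ cuspSet n k} = ∅ := by
      ext y
      simp only [Set.mem_ofPred_eq, Set.mem_empty_iff_false, iff_false, not_and]
      exact fun hy h => hη ((strictMono_mem_cuspSet_iff η hy).1 h).2
    rw [hset, Measure.restrict_empty, integral_zero_measure]

theorem integral_logIntegrand_eq_Ftilde {n : ℕ} {m : Fin n → ℝ} (hm : ∀ i, 0 ≤ m i)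
    {mm : Fin n → Fin n → ℝ} (hsymm : ∀ i j, mm i j = mm j i)
    (hmm : ∀ i j : Fin n, i < j → 0 ≤ mm i j) :
    ∫ y in openSimplex n, logIntegrand m mm (fun i => 2 * Real.pi * Complex.I * y i) =
      Ftilde n m mm := by
  have h := pathIntegral_zero m mm
  rw [pathIntegral_zero_eq_sum hm hmm] at h
  have hne : (2 * Real.pi * Complex.I) ^ n ≠ 0 := pow_ne_zero _ Complex.two_pi_I_ne_zero
  rw [eq_comm, ← eq_inv_mul_iff_mul_eq₀ hne, ← inv_pow] at h
  rw [h, Ftilde]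
  congr 1
  refine Finset.sum_congr rfl fun k _ => ?_
  rw [integral_cuspSet hm hsymm hmm k, ← mul_assoc]
  congr 1
  refine Finset.sum_congr rfl fun η _ => ?_
  congr 1
  symm
  convert prod_filter_pairs (fun i j => η j < η i)
    (fun i j => Complex.exp (Real.pi * Complex.I * mm i j)) using 2
  · ext p
    simp
  · split_ifs <;> rfl

/-- **Quantum Symmetrizer Formula** (Theorem 5.5 of the paper): for `n ≥ 1`,
nonnegative `m_i`, nonnegative symmetric `m_{ij}` satisfying fracturedness,
`F₋((m_i, m_{ij})_{ij}) = ∑_{σ ∈ S_n} q(σ) · F̃₋((m_{σ⁻¹(i)}; m_{σ⁻¹(i)σ⁻¹(j)})_{ij})`. -/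
theorem quantum_symmetrizer_formula (n : ℕ) (hn : 1 ≤ n)
    (m : Fin n → ℝ) (mm : Fin n → Fin n → ℝ)
    (hsymm : ∀ i j, mm i j = mm j i)
    (hm : ∀ i, 0 ≤ m i) (hmm : ∀ i j : Fin n, i < j → 0 ≤ mm i j)
    (hfrac : ∀ i : Fin n,
      ¬ ∃ z : ℤ, (z : ℝ) = m i + ∑ j ∈ Finset.univ.filter (fun j => i < j), mm i j) :
    Fminus n m mm =
      ∑ σ : Equiv.Perm (Fin n), qfac mm σ *
        Ftilde n (fun i => m (σ⁻¹ i)) (fun i j => mm (σ⁻¹ i) (σ⁻¹ j)) := by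
  rw [Fminus_eq_sum hsymm hmm hfrac]
  refine Finset.sum_congr rfl fun σ _ => ?_
  rw [integral_logIntegrand_eq_Ftilde (fun i => hm _) (fun i j => hsymm _ _)]
  intro i j hij
  rcases lt_or_gt_of_ne (σ⁻¹.injective.ne hij.ne) with h | h
  · exact hmm _ _ h
  · rw [hsymm]
    exact hmm _ _ h
end

section
/- Let m₁, m₂, m₁₂ be real numbers with m₂ > −1, m₁₂ > −1, and m₁ + m₂ + m₁₂ + 2 > 0. Then the double Lebesgue integral over the triangle {(z₁,z₂) : 1 ≥ z₁ > z₂ ≥ 0} of z₁^{m₁} z₂^{m₂} (z₁ − z₂)^{m₁₂} equals B(m₂+1, m₁₂+1)/(m₁ + m₂ + m₁₂ + 2). -/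
open MeasureTheory
open scoped Classical

theorem intervalIntegrable_rpow_mul_one_sub_rpow {a b : ℝ} (ha : -1 < a) (hb : -1 < b) :
    IntervalIntegrable (fun t : ℝ => t ^ a * (1 - t) ^ b) volume 0 1 := by
  have h := (Complex.betaIntegral_convergent (u := ((a + 1 : ℝ) : ℂ)) (v := ((b + 1 : ℝ) : ℂ))
    (by rw [Complex.ofReal_re]; linarith) (by rw [Complex.ofReal_re]; linarith)).norm
  refine h.congr fun t ht => ?_
  rw [Set.uIoc_of_le zero_le_one] at ht
  have h0 : 0 ≤ t := ht.1.le
  have h1 : 0 ≤ 1 - t := sub_nonneg.2 ht.2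
  have e : ((t : ℂ) ^ (((a + 1 : ℝ) : ℂ) - 1) * (1 - (t : ℂ)) ^ (((b + 1 : ℝ) : ℂ) - 1))
      = ((t ^ a * (1 - t) ^ b : ℝ) : ℂ) := by
    rw [Complex.ofReal_mul, Complex.ofReal_cpow h0, Complex.ofReal_cpow h1]
    push_cast
    simp only [add_sub_cancel_right]
  rw [e, Complex.norm_real, Real.norm_of_nonneg (by positivity)]

theorem rpow_mul_rpow_mul_sub_rpow_eq_scaled {x y : ℝ} (hx : 0 < x) (hy : 0 ≤ y) (hyx : y ≤ x)
    (a b c : ℝ) :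
    x ^ a * y ^ b * (x - y) ^ c = x ^ (a + b + c) * ((y / x) ^ b * (1 - y / x) ^ c) := by
  have e : 1 - y / x = (x - y) / x := by field_simp
  have hb := (Real.rpow_pos_of_pos hx b).ne'
  have hc := (Real.rpow_pos_of_pos hx c).ne'
  rw [e, Real.div_rpow hy hx.le, Real.div_rpow (sub_nonneg.2 hyx) hx.le, Real.rpow_add hx,
    Real.rpow_add hx]
  field_simp

theorem intervalIntegrable_rpow_mul_rpow_mul_sub_rpow {x : ℝ} (hx : 0 < x) (a : ℝ) {b c : ℝ}
    (hb : -1 < b) (hc : -1 < c) :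
    IntervalIntegrable (fun y : ℝ => x ^ a * y ^ b * (x - y) ^ c) volume 0 x := by
  have h := (intervalIntegrable_rpow_mul_one_sub_rpow hb hc).comp_mul_left (c := x⁻¹)
  simp only [zero_div, one_div, inv_inv] at h
  refine (h.const_mul (x ^ (a + b + c))).congr fun y hy => ?_
  rw [Set.uIoc_of_le hx.le] at hy
  rw [rpow_mul_rpow_mul_sub_rpow_eq_scaled hx hy.1.le hy.2, inv_mul_eq_div]

theorem integral_rpow_mul_rpow_mul_sub_rpow {x : ℝ} (hx : 0 < x) (a b c : ℝ) :
    ∫ y in (0 : ℝ)..x, x ^ a * y ^ b * (x - y) ^ c =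
      x ^ (a + b + c + 1) * Beta (b + 1) (c + 1) := by
  rw [intervalIntegral.integral_congr
    (g := fun y => x ^ (a + b + c) * ((y / x) ^ b * (1 - y / x) ^ c))]
  · rw [intervalIntegral.integral_const_mul,
      intervalIntegral.integral_comp_div (fun t => t ^ b * (1 - t) ^ c) hx.ne', zero_div,
      div_self hx.ne', Real.rpow_add_one hx.ne', Beta]
    simp only [add_sub_cancel_right, smul_eq_mul, mul_assoc]
  · intro y hy
    rw [Set.uIcc_of_le hx.le] at hy
    exact rpow_mul_rpow_mul_sub_rpow_eq_scaled hx hy.1 hy.2 a b c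

/-- The double integral over the triangle `1 ≥ z₁ > z₂ ≥ 0` of
`z₁^{m₁} z₂^{m₂} (z₁ − z₂)^{m₁₂}` equals `B(m₂+1, m₁₂+1)/(m₁+m₂+m₁₂+2)`. -/
theorem triangle_integral_eq_beta (m₁ m₂ m₁₂ : ℝ)
    (h2 : -1 < m₂) (h12 : -1 < m₁₂) (hsum : 0 < m₁ + m₂ + m₁₂ + 2) :
    (∫ p in {p : ℝ × ℝ | 0 ≤ p.2 ∧ p.2 < p.1 ∧ p.1 ≤ 1},
        p.1 ^ m₁ * p.2 ^ m₂ * (p.1 - p.2) ^ m₁₂) =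
      Beta (m₂ + 1) (m₁₂ + 1) / (m₁ + m₂ + m₁₂ + 2) := by
  set T : Set (ℝ × ℝ) := {p | 0 ≤ p.2 ∧ p.2 < p.1 ∧ p.1 ≤ 1} with hT
  set f : ℝ × ℝ → ℝ := fun p => p.1 ^ m₁ * p.2 ^ m₂ * (p.1 - p.2) ^ m₁₂ with hf
  have hTm : MeasurableSet T :=
    (measurableSet_le measurable_const measurable_snd).inter
      ((measurableSet_lt measurable_snd measurable_fst).inter
        (measurableSet_le measurable_fst measurable_const))
  have hfm : Measurable f := by fun_prop
  have hnonneg : ∀ p, 0 ≤ T.indicator f p := fun p =>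
    Set.indicator_nonneg (fun q hq => mul_nonneg (mul_nonneg
      (Real.rpow_nonneg (hq.1.trans hq.2.1.le) _) (Real.rpow_nonneg hq.1 _))
      (Real.rpow_nonneg (sub_nonneg.2 hq.2.1.le) _)) p
  have hin : ∀ x ∈ Set.Ioc (0 : ℝ) 1, (fun y => T.indicator f (x, y)) =
      (Set.Ico 0 x).indicator (fun y => x ^ m₁ * y ^ m₂ * (x - y) ^ m₁₂) := by
    intro x hx
    ext y
    simp [Set.indicator_apply, hT, hf, hx.2]
  have hout : ∀ x ∉ Set.Ioc (0 : ℝ) 1, (fun y => T.indicator f (x, y)) = 0 := by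
    intro x hx
    ext y
    exact Set.indicator_of_notMem (fun h => hx ⟨h.1.trans_lt h.2.1, h.2.2⟩) f
  have hsection_integrable : ∀ x, Integrable (fun y => T.indicator f (x, y)) := by
    intro x
    by_cases hx : x ∈ Set.Ioc (0 : ℝ) 1
    · rw [hin x hx, integrable_indicator_iff measurableSet_Ico,
        integrableOn_Ico_iff_integrableOn_Ioo, ← integrableOn_Ioc_iff_integrableOn_Ioo,
        ← intervalIntegrable_iff_integrableOn_Ioc_of_le hx.1.le]
      exact intervalIntegrable_rpow_mul_rpow_mul_sub_rpow hx.1 m₁ h2 h12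
    · rw [hout x hx]
      exact integrable_zero _ _ _
  have hsection_integral : (fun x => ∫ y, T.indicator f (x, y)) = (Set.Ioc (0 : ℝ) 1).indicator
      (fun x => x ^ (m₁ + m₂ + m₁₂ + 1) * Beta (m₂ + 1) (m₁₂ + 1)) := by
    ext x
    by_cases hx : x ∈ Set.Ioc (0 : ℝ) 1
    · rw [hin x hx, integral_indicator measurableSet_Ico, Set.indicator_of_mem hx,
        integral_Ico_eq_integral_Ioo, ← integral_Ioc_eq_integral_Ioo,
        ← intervalIntegral.integral_of_le hx.1.le, integral_rpow_mul_rpow_mul_sub_rpow hx.1]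
    · rw [hout x hx, Set.indicator_of_notMem hx]
      exact integral_zero _ _
  have hexp : -1 < m₁ + m₂ + m₁₂ + 1 := by linarith
  have hint : Integrable (T.indicator f) (volume.prod volume) := by
    rw [integrable_prod_iff (hfm.indicator hTm).aestronglyMeasurable]
    refine ⟨Filter.Eventually.of_forall hsection_integrable, ?_⟩
    simp only [Real.norm_of_nonneg (hnonneg _)]
    rw [hsection_integral, integrable_indicator_iff measurableSet_Ioc,
      ← intervalIntegrable_iff_integrableOn_Ioc_of_le zero_le_one]
    exact (intervalIntegral.intervalIntegrable_rpow' hexp).mul_const _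
  rw [← integral_indicator hTm, Measure.volume_eq_prod, integral_prod _ hint, hsection_integral,
    integral_indicator measurableSet_Ioc, ← intervalIntegral.integral_of_le zero_le_one,
    intervalIntegral.integral_mul_const, integral_rpow (Or.inl hexp), Real.one_rpow,
    Real.zero_rpow (by linarith)]
  ring
end

section
/- Let n ≥ 1 and let (m_i)_{1≤i≤n}, (m_{ij})_{1≤i<j≤n} be real numbers with m_i > −1 for all i and m_{ij} ≥ 0 for all i < j. Then Sel((m_i; 0; m_{ij})) = (n + ∑_i m_i + ∑_{i<j} m_{ij})^{−1} · ∫_{1≥z₂>⋯>zₙ≥0} ∏_{i=2}^n z_i^{m_i} (1−z_i)^{m_{1i}} · ∏_{2≤i<j≤n} (z_i − z_j)^{m_{ij}} dz₂⋯dzₙ. -/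
open MeasureTheory
open scoped Classical

namespace UT

/-- A product over pairs `i < j` in `Fin (n + 1)` splits off the pairs with `i = 0`. -/
@[to_additive]
theorem prod_univ_succ {M : Type*} [CommMonoid M] {n : ℕ}
    (f : Fin (n + 1) → Fin (n + 1) → M) :
    ∏ p : UT (n + 1), f p.1.1 p.1.2 =
      (∏ i : Fin n, f 0 i.succ) * ∏ p : UT n, f p.1.1.succ p.1.2.succ := by
  have key : ∀ (k : ℕ) (g : Fin k → Fin k → M),
      ∏ p : UT k, g p.1.1 p.1.2 = ∏ i, ∏ j, if i < j then g i j else 1 := by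
    intro k g
    rw [← Fintype.prod_prod_type' (f := fun i j => if i < j then g i j else 1),
      ← Finset.prod_filter]
    exact (Finset.prod_subtype _ (by simp) (fun p : Fin k × Fin k => g p.1 p.2)).symm
  rw [key, key n fun i j => f i.succ j.succ, Fin.prod_univ_succ]
  simp [Fin.prod_univ_succ]

end UT

theorem measurableSet_simplexSet (n : ℕ) : MeasurableSet (simplexSet n) := by
  unfold simplexSet
  measurability

/-- The integrand of the generalized Selberg integral. -/
noncomputable def selIntegrand (n : ℕ) (m mbar : Fin n → ℝ) (mm : Fin n → Fin n → ℝ)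
    (z : Fin n → ℝ) : ℝ :=
  (∏ i, z i ^ m i) * (∏ i, (1 - z i) ^ mbar i) *
    ∏ p : UT n, (z p.1.1 - z p.1.2) ^ mm p.1.1 p.1.2

theorem measurable_selIntegrand (n : ℕ) (m mbar : Fin n → ℝ) (mm : Fin n → Fin n → ℝ) :
    Measurable (selIntegrand n m mbar mm) := by
  unfold selIntegrand
  fun_prop

theorem selIntegrand_nonneg {n : ℕ} (m mbar : Fin n → ℝ) (mm : Fin n → Fin n → ℝ)
    {z : Fin n → ℝ} (hz : z ∈ simplexSet n) : 0 ≤ selIntegrand n m mbar mm z := by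
  refine mul_nonneg (mul_nonneg ?_ ?_) ?_ <;> refine Finset.prod_nonneg fun i _ => ?_
  · exact Real.rpow_nonneg (hz.1 i).1 _
  · exact Real.rpow_nonneg (sub_nonneg.2 (hz.1 i).2) _
  · exact Real.rpow_nonneg (sub_nonneg.2 (hz.2 _ _ i.2).le) _

theorem Sel_eq_toReal_lintegral (n : ℕ) (m mbar : Fin n → ℝ) (mm : Fin n → Fin n → ℝ) :
    Sel n m mbar mm =
      (∫⁻ z, (simplexSet n).indicator
        (fun z => ENNReal.ofReal (selIntegrand n m mbar mm z)) z).toReal := by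
  rw [lintegral_indicator (measurableSet_simplexSet n)]
  refine integral_eq_lintegral_of_nonneg_ae ?_
    (measurable_selIntegrand n m mbar mm).aestronglyMeasurable
  filter_upwards [ae_restrict_mem (measurableSet_simplexSet n)] with z hz
  exact selIntegrand_nonneg m mbar mm hz

theorem lintegral_comp_smul_pi {ι : Type*} [Fintype ι] (f : (ι → ℝ) → ENNReal)
    {t : ℝ} (ht : t ≠ 0) :
    ∫⁻ w, f w = ENNReal.ofReal |t ^ Fintype.card ι| * ∫⁻ w, f (t • w) := by
  have h := lintegral_map_equiv (μ := (volume : Measure (ι → ℝ))) f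
    (MeasurableEquiv.smul (Units.mk0 t ht))
  have hmap : Measure.map (MeasurableEquiv.smul (Units.mk0 t ht)) (volume : Measure (ι → ℝ)) =
      ENNReal.ofReal |(t ^ Fintype.card ι)⁻¹| • volume := by
    simpa using Measure.map_addHaar_smul (volume : Measure (ι → ℝ)) ht
  rw [hmap, lintegral_smul_measure] at h
  change _ = ∫⁻ w, f (t • w) at h
  rw [← h, smul_eq_mul, ← mul_assoc, ← ENNReal.ofReal_mul (abs_nonneg _), ← abs_mul,
    mul_inv_cancel₀ (pow_ne_zero _ ht)]
  simp

/-- Integration in the coordinates `(t, w) ↦ (t, t w)`. -/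
theorem lintegral_fin_succ_eq_lintegral_cons_smul {n : ℕ} {f : (Fin (n + 1) → ℝ) → ENNReal}
    (hf : Measurable f) :
    ∫⁻ z, f z = ∫⁻ t : ℝ, ENNReal.ofReal |t ^ n| *
      ∫⁻ w : Fin n → ℝ, f (Fin.cons t (t • w)) := by
  have e := (volume_preserving_piFinSuccAbove (fun _ : Fin (n + 1) => ℝ) 0).symm
  rw [← e.lintegral_comp hf, Measure.volume_eq_prod,
    lintegral_prod (fun a => f ((MeasurableEquiv.piFinSuccAbove (fun _ => ℝ) 0).symm a))
      (hf.comp e.measurable).aemeasurable]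
  refine lintegral_congr_ae ?_
  filter_upwards [Measure.ae_ne volume (0 : ℝ)] with t ht
  rw [lintegral_comp_smul_pi _ ht, Fintype.card_fin]
  simp [MeasurableEquiv.piFinSuccAbove, Fin.insertNthEquiv, Fin.insertNth_zero']

theorem cons_smul_mem_simplexSet_iff {n : ℕ} {t : ℝ} {w : Fin n → ℝ} (ht : t ≠ 0)
    (hw : ∀ i, w i ≠ 1) :
    (Fin.cons t (t • w) : Fin (n + 1) → ℝ) ∈ simplexSet (n + 1) ↔
      t ∈ Set.Ioc 0 1 ∧ w ∈ simplexSet n := by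
  have aux : ∀ ht0 : 0 < t, t ≤ 1 → ((∀ i, 0 ≤ w i ∧ t * w i ≤ 1 ∧ w i < 1) ↔
      ∀ i, 0 ≤ w i ∧ w i ≤ 1) := fun ht0 ht1 =>
    forall_congr' fun i => ⟨fun h => ⟨h.1, h.2.2.le⟩, fun h =>
      ⟨h.1, mul_le_one₀ ht1 h.1 h.2, lt_of_le_of_ne h.2 (hw i)⟩⟩
  simp only [simplexSet, Set.mem_ofPred_eq, Fin.forall_fin_succ, Fin.cons_zero, Fin.cons_succ,
    Pi.smul_apply, smul_eq_mul, Set.mem_Ioc, Fin.succ_pos, Fin.not_lt_zero,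
    Fin.succ_lt_succ_iff, IsEmpty.forall_iff, forall_const, true_and]
  constructor
  · rintro ⟨⟨⟨h0, h1⟩, h⟩, h2, h3⟩
    have ht0 := lt_of_le_of_ne h0 ht.symm
    refine ⟨⟨ht0, h1⟩, (aux ht0 h1).1 fun i => ⟨?_, (h i).2, ?_⟩, fun i j hij => ?_⟩
    · exact nonneg_of_mul_nonneg_right (h i).1 ht0
    · exact (mul_lt_iff_lt_one_right ht0).1 (h2 i)
    · exact lt_of_mul_lt_mul_left (h3 i j hij) h0
  · rintro ⟨⟨ht0, h1⟩, h, h3⟩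
    have h' := (aux ht0 h1).2 h
    exact ⟨⟨⟨ht0.le, h1⟩, fun i => ⟨mul_nonneg ht0.le (h' i).1, (h' i).2.1⟩⟩,
      fun i => (mul_lt_iff_lt_one_right ht0).2 (h' i).2.2,
      fun i j hij => mul_lt_mul_of_pos_left (h3 i j hij) ht0⟩

theorem selIntegrand_cons_smul {n : ℕ} (m : Fin (n + 1) → ℝ) (mm : Fin (n + 1) → Fin (n + 1) → ℝ)
    {t : ℝ} (ht : 0 < t) {w : Fin n → ℝ} (hw : w ∈ simplexSet n) :
    selIntegrand (n + 1) m (fun _ => 0) mm (Fin.cons t (t • w)) =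
      t ^ ((∑ i, m i) + ∑ p : UT (n + 1), mm p.1.1 p.1.2) *
        selIntegrand n (fun i => m i.succ) (fun i => mm 0 i.succ)
          (fun i j => mm i.succ j.succ) w := by
  have h1 : ∀ i, (t * w i) ^ m i.succ = t ^ m i.succ * w i ^ m i.succ := fun i =>
    Real.mul_rpow ht.le (hw.1 i).1
  have h2 : ∀ i, (t - t * w i) ^ mm 0 i.succ = t ^ mm 0 i.succ * (1 - w i) ^ mm 0 i.succ :=
    fun i => by rw [← mul_one_sub, Real.mul_rpow ht.le (sub_nonneg.2 (hw.1 i).2)]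
  have h3 : ∀ p : UT n, (t * w p.1.1 - t * w p.1.2) ^ mm p.1.1.succ p.1.2.succ =
      t ^ mm p.1.1.succ p.1.2.succ * (w p.1.1 - w p.1.2) ^ mm p.1.1.succ p.1.2.succ :=
    fun p => by rw [← mul_sub, Real.mul_rpow ht.le (sub_nonneg.2 (hw.2 _ _ p.2).le)]
  unfold selIntegrand
  rw [UT.prod_univ_succ (fun i j => ((Fin.cons t (t • w) : Fin (n + 1) → ℝ) i -
      (Fin.cons t (t • w) : Fin (n + 1) → ℝ) j) ^ mm i j), UT.sum_univ_succ mm,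
    Fin.prod_univ_succ, Fin.sum_univ_succ]
  simp only [Fin.cons_zero, Fin.cons_succ, Pi.smul_apply, smul_eq_mul, h1, h2, h3,
    Real.rpow_zero, Finset.prod_const_one, Finset.prod_mul_distrib, Real.rpow_add ht,
    Real.rpow_sum_of_pos ht]
  ring

theorem toReal_lintegral_indicator_rpow {D : ℝ} (hD : 0 < D) :
    (∫⁻ t : ℝ, (Set.Ioc (0 : ℝ) 1).indicator
      (fun t => ENNReal.ofReal (t ^ (D - 1))) t).toReal = D⁻¹ := by
  rw [lintegral_indicator measurableSet_Ioc, ← integral_eq_lintegral_of_nonneg_ae,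
    ← intervalIntegral.integral_of_le zero_le_one, integral_rpow (Or.inl (by linarith))]
  · simp [hD.ne']
  · filter_upwards [ae_restrict_mem measurableSet_Ioc] with t ht
    exact Real.rpow_nonneg ht.1.le _
  · exact Measurable.aestronglyMeasurable (by fun_prop)

theorem total_exponent_pos {n : ℕ} {m : Fin (n + 1) → ℝ} {mm : Fin (n + 1) → Fin (n + 1) → ℝ}
    (hm : ∀ i, -1 < m i) (hmm : ∀ i j : Fin (n + 1), i < j → 0 ≤ mm i j) :
    0 < ((n : ℝ) + 1) + (∑ i, m i) + ∑ p : UT (n + 1), mm p.1.1 p.1.2 := by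
  have h1 : 0 < ∑ i, (1 + m i) :=
    Finset.sum_pos (fun i _ => by linarith [hm i]) Finset.univ_nonempty
  have h2 : 0 ≤ ∑ p : UT (n + 1), mm p.1.1 p.1.2 := Finset.sum_nonneg fun p _ => hmm _ _ p.2
  simp only [Finset.sum_add_distrib, Finset.sum_const, Finset.card_univ, Fintype.card_fin,
    nsmul_eq_mul, mul_one, Nat.cast_add, Nat.cast_one] at h1
  linarith

/-- Reduction of the `(n+1)`-fold Selberg integral: substituting `z_i/z_1` and
integrating out `z_1` gives
`Sel((m_i; 0; m_{ij})) = (n+1 + ∑ m_i + ∑ m_{ij})⁻¹ · Sel((m_{i+1}; m_{1,i+1}; m_{i+1,j+1}))`. -/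
theorem Sel_reduction (n : ℕ) (m : Fin (n + 1) → ℝ) (mm : Fin (n + 1) → Fin (n + 1) → ℝ)
    (hm : ∀ i, -1 < m i) (hmm : ∀ i j : Fin (n + 1), i < j → 0 ≤ mm i j) :
    Sel (n + 1) m (fun _ => 0) mm =
      (((n : ℝ) + 1) + (∑ i, m i) + ∑ p : UT (n + 1), mm p.1.1 p.1.2)⁻¹ *
        Sel n (fun i => m i.succ) (fun i => mm 0 i.succ) (fun i j => mm i.succ j.succ) := by
  rw [Sel_eq_toReal_lintegral, Sel_eq_toReal_lintegral,
    ← toReal_lintegral_indicator_rpow (total_exponent_pos hm hmm), ← ENNReal.toReal_mul,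
    lintegral_fin_succ_eq_lintegral_cons_smul
      ((measurable_selIntegrand _ _ _ _).ennreal_ofReal.indicator (measurableSet_simplexSet _)),
    ← lintegral_mul_const _ (Measurable.indicator (by fun_prop) measurableSet_Ioc)]
  congr 1
  refine lintegral_congr_ae ?_
  filter_upwards [Measure.ae_ne volume (0 : ℝ)] with t ht
  rw [← lintegral_const_mul' _ _ ENNReal.ofReal_ne_top,
    ← lintegral_const_mul _ ((measurable_selIntegrand _ _ _ _).ennreal_ofReal.indicator
      (measurableSet_simplexSet _))]
  refine lintegral_congr_ae ?_
  have hae : ∀ᵐ w : Fin n → ℝ, ∀ i, w i ≠ 1 :=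
    ae_all_iff.2 fun i => Measure.ae_eval_ne (μ := fun _ : Fin n => volume) i 1
  filter_upwards [hae] with w hw
  have hiff := cons_smul_mem_simplexSet_iff ht hw
  by_cases h : t ∈ Set.Ioc (0 : ℝ) 1 ∧ w ∈ simplexSet n
  · rw [Set.indicator_of_mem (hiff.2 h), Set.indicator_of_mem h.1, Set.indicator_of_mem h.2,
      selIntegrand_cons_smul m mm h.1.1 h.2, ← ENNReal.ofReal_mul (abs_nonneg _),
      ← ENNReal.ofReal_mul (Real.rpow_nonneg h.1.1.le _), ← mul_assoc,
      abs_of_pos (pow_pos h.1.1 n), ← Real.rpow_natCast, ← Real.rpow_add h.1.1]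
    ring_nf
  · rw [Set.indicator_of_notMem (mt hiff.1 h), mul_zero]
    rcases not_and_or.1 h with h | h <;> simp [Set.indicator_of_notMem h]
end

section
/- Let n ≥ 1 and let m, μ be real numbers with 2μ + (n−1)m ∈ 2ℤ. Then ∑_{k=0}^n (−1)^k e^{2πi μ (n−k)} ∑_{η ∈ S_{k,n−k}bar} e^{πi m ℓ(η)} = 0. -/
open MeasureTheory
open scoped Classical

/-- The inversion number as a double sum of indicators. -/
lemma invNum_eq_sum {n : ℕ} (η : Equiv.Perm (Fin n)) :
    invNum η = ∑ i, ∑ j, if i < j ∧ η j < η i then 1 else 0 := by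
  rw [invNum, Finset.card_filter, Fintype.sum_prod_type]

/-- Moving the minimal value from the first to the last position creates `N` inversions. -/
lemma invNum_mul_finRotate {N : ℕ} (η : Equiv.Perm (Fin (N + 1))) (h0 : η 0 = 0) :
    invNum (η * finRotate (N + 1)) = invNum η + N := by
  have hpos (i : Fin N) : 0 < η i.succ := by
    rw [Fin.pos_iff_ne_zero, ← h0]
    exact η.injective.ne (Fin.succ_ne_zero i)
  have hlast (i : Fin N) : ¬ Fin.last N < i.castSucc := (Fin.castSucc_lt_last i).not_gt
  rw [invNum_eq_sum, invNum_eq_sum]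
  conv_lhs => simp only [Fin.sum_univ_castSucc]
  conv_rhs => simp only [Fin.sum_univ_succ]
  simp [h0, hpos, hlast, Finset.sum_add_distrib]

/-- If the minimal value of a shuffle lies in the increasing block, it is in first position. -/
lemma apply_zero_of_mem_SbarFinset {N k : ℕ} {η : Equiv.Perm (Fin (N + 1))}
    (hη : η ∈ SbarFinset (N + 1) k) (hmin : (η⁻¹ 0 : Fin (N + 1)).val < k) : η 0 = 0 := by
  have hinv : η (η⁻¹ 0) = 0 := η.apply_symm_apply 0
  by_contra hne
  have hp : 0 < η⁻¹ 0 := by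
    rw [Fin.pos_iff_ne_zero]
    intro h
    rw [h] at hinv
    exact hne hinv
  have := (Finset.mem_filter.1 hη).2.1 0 (η⁻¹ 0) hp hmin
  rw [hinv] at this
  exact absurd this (Fin.not_lt_zero _)

/-- The shuffles whose minimal value lies in the increasing block correspond, by moving that value
to the last position, to the shuffles of the next smaller `k` whose minimal value lies in the
decreasing block. -/
lemma mem_SbarFinset_succ_iff {N k : ℕ} (hk : k ≤ N) (η : Equiv.Perm (Fin (N + 1))) :
    (η ∈ SbarFinset (N + 1) (k + 1) ∧ (η⁻¹ 0 : Fin (N + 1)).val < k + 1) ↔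
      (η * finRotate (N + 1) ∈ SbarFinset (N + 1) k ∧
        ¬ ((η * finRotate (N + 1))⁻¹ 0 : Fin (N + 1)).val < k) := by
  have hpos (h0 : η 0 = 0) (i : Fin N) : 0 < η i.succ := by
    rw [Fin.pos_iff_ne_zero, ← h0]
    exact η.injective.ne (Fin.succ_ne_zero i)
  have hη' : (η * finRotate (N + 1)) ((η * finRotate (N + 1))⁻¹ 0) = 0 :=
    (η * finRotate (N + 1)).apply_symm_apply 0
  simp only [SbarFinset, Finset.mem_filter, Finset.mem_univ, true_and]
  constructor
  · intro h
    have h0 : η 0 = 0 := apply_zero_of_mem_SbarFinset (by simpa [SbarFinset] using h.1) h.2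
    obtain ⟨⟨hinc, hdec⟩, hmin⟩ := h
    refine ⟨⟨fun i j hij hj => ?_, fun i j hij hi => ?_⟩, ?_⟩
    · cases i using Fin.lastCases with
      | last => exact absurd hij (Fin.le_last j).not_gt
      | cast i =>
      cases j using Fin.lastCases with
      | last => simp at hj; omega
      | cast j =>
      simp at hj hij ⊢
      exact hinc _ _ (by simpa using hij) (by simpa using hj)
    · cases i using Fin.lastCases with
      | last => exact absurd hij (Fin.le_last j).not_gt
      | cast i =>
      cases j using Fin.lastCases with
      | last => simpa [h0] using hpos h0 i
      | cast j =>
      simp at hi hij ⊢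
      exact hdec _ _ (by simpa using hij) (by simpa using hi)
    · have : (η * finRotate (N + 1))⁻¹ 0 = Fin.last N := by
        rw [Equiv.Perm.inv_eq_iff_eq]
        simp [h0]
      rw [this, Fin.val_last]
      omega
  · rintro ⟨⟨hinc, hdec⟩, hmin⟩
    have hlast : (η * finRotate (N + 1))⁻¹ 0 = Fin.last N := by
      by_contra hne
      have := hdec _ _ (Fin.lt_last_iff_ne_last.2 hne) (not_lt.1 hmin)
      rw [hη'] at this
      exact absurd this (Fin.not_lt_zero _)
    have h0 : η 0 = 0 := by
      rw [hlast] at hη'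
      simpa using hη'
    refine ⟨⟨fun i j hij hj => ?_, fun i j hij hi => ?_⟩, ?_⟩
    · cases j using Fin.cases with
      | zero => exact absurd hij (Fin.not_lt_zero _)
      | succ j =>
      cases i using Fin.cases with
      | zero => rw [h0]; exact hpos h0 j
      | succ i =>
      simpa using hinc i.castSucc j.castSucc (by simpa using hij) (by simpa using hj)
    · cases i using Fin.cases with
      | zero => simp at hi
      | succ i =>
      cases j using Fin.cases with
      | zero => exact absurd hij (Fin.not_lt_zero _)
      | succ j =>
      simpa using hdec i.castSucc j.castSucc (by simpa using hij) (by simpa using hi)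
    · have : η⁻¹ 0 = 0 := by
        rw [Equiv.Perm.inv_eq_iff_eq, h0]
      rw [this]
      simp

/-- The weighted correspondence between the shuffles with minimal value in the increasing block
and those with minimal value in the decreasing block. -/
lemma sum_pow_invNum_not_lt {R : Type*} [CommSemiring R] (q : R) {N k : ℕ} (hk : k ≤ N) :
    ∑ η ∈ SbarFinset (N + 1) k with ¬ (η⁻¹ 0 : Fin (N + 1)).val < k, q ^ invNum η =
      q ^ N * ∑ η ∈ SbarFinset (N + 1) (k + 1) with (η⁻¹ 0 : Fin (N + 1)).val < k + 1,
        q ^ invNum η := by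
  rw [Finset.mul_sum]
  symm
  refine Finset.sum_equiv (Equiv.mulRight (finRotate (N + 1))) (fun η => ?_) (fun η hη => ?_)
  · rw [Finset.mem_filter, Finset.mem_filter]
    exact mem_SbarFinset_succ_iff hk η
  · obtain ⟨hS, hmin⟩ := Finset.mem_filter.1 hη
    have h0 : η 0 = 0 := apply_zero_of_mem_SbarFinset hS hmin
    rw [Equiv.coe_mulRight, invNum_mul_finRotate η h0, pow_add, mul_comm]

/-- The signed shuffle sum vanishes as soon as `Q * q ^ N = 1`. -/
lemma sum_neg_one_pow_mul_sum_pow_invNum {R : Type*} [CommRing R] {q Q : R} {N : ℕ}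
    (hQ : Q * q ^ N = 1) :
    ∑ k ∈ Finset.range (N + 2), (-1) ^ k * Q ^ (N + 1 - k) *
      ∑ η ∈ SbarFinset (N + 1) k, q ^ invNum η = 0 := by
  have hsplit (k : ℕ) := Finset.sum_filter_add_sum_filter_not (SbarFinset (N + 1) k)
    (fun η => (η⁻¹ 0 : Fin (N + 1)).val < k) (fun η => q ^ invNum η)
  have htop : ∑ η ∈ SbarFinset (N + 1) (N + 1) with ¬ (η⁻¹ 0 : Fin (N + 1)).val < N + 1,
      q ^ invNum η = 0 := by
    rw [Finset.filter_false_of_mem fun η _ => not_not.2 (η⁻¹ 0).is_lt, Finset.sum_empty]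
  simp_rw [← hsplit, mul_add, Finset.sum_add_distrib]
  rw [Finset.sum_range_succ', Finset.sum_range_succ (n := N + 1), htop]
  simp only [not_lt_zero, Finset.filter_false, Finset.sum_empty, mul_zero, add_zero]
  rw [← Finset.sum_add_distrib]
  refine Finset.sum_eq_zero fun k hk => ?_
  have hk : k ≤ N := Nat.lt_succ_iff.1 (Finset.mem_range.1 hk)
  rw [sum_pow_invNum_not_lt q hk, Nat.succ_sub hk, pow_succ Q, Nat.add_sub_add_right]
  linear_combination (-1) ^ k * Q ^ (N - k) * hQ *
    ∑ η ∈ SbarFinset (N + 1) (k + 1) with (η⁻¹ 0 : Fin (N + 1)).val < k + 1, q ^ invNum η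

/-- Vanishing of the shuffle sum (Lemma `lm_NicholsRepVanishing`): if
`2μ + (n−1)m ∈ 2ℤ` then `∑_{k=0}^n (−1)^k e^{2πiμ(n−k)} ∑_{η ∈ S_{k,n−k}bar} e^{πi m ℓ(η)} = 0`. -/
theorem shuffle_sum_vanishes (n : ℕ) (hn : 1 ≤ n) (m μ : ℝ)
    (h : ∃ z : ℤ, 2 * μ + ((n : ℝ) - 1) * m = 2 * (z : ℝ)) :
    ∑ k ∈ Finset.range (n + 1), (-1 : ℂ) ^ k *
        Complex.exp (2 * Real.pi * Complex.I * μ * ((n : ℂ) - k)) *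
        ∑ η ∈ SbarFinset n k,
          Complex.exp (Real.pi * Complex.I * m * (invNum η : ℂ)) = 0 := by
  obtain ⟨N, rfl⟩ := Nat.exists_eq_add_of_le' hn
  obtain ⟨z, hz⟩ := h
  have hQ : Complex.exp (2 * Real.pi * Complex.I * μ) *
      Complex.exp (Real.pi * Complex.I * m) ^ N = 1 := by
    rw [← Complex.exp_nat_mul, ← Complex.exp_add, Complex.exp_eq_one_iff]
    refine ⟨z, ?_⟩
    have hz' : 2 * (μ : ℂ) + N * m = 2 * z := by
      push_cast at hz
      rw [add_sub_cancel_right] at hz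
      exact_mod_cast hz
    linear_combination (Real.pi * Complex.I) * hz'
  rw [← sum_neg_one_pow_mul_sum_pow_invNum hQ]
  refine Finset.sum_congr rfl fun k hk => ?_
  have hk : k ≤ N + 1 := Nat.lt_succ_iff.1 (Finset.mem_range.1 hk)
  congr 1
  · rw [← Complex.exp_nat_mul, Nat.cast_sub hk, mul_comm (2 * Real.pi * Complex.I * μ : ℂ)]
  · refine Finset.sum_congr rfl fun η _ => ?_
    rw [← Complex.exp_nat_mul, mul_comm]
end
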